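/- arXiv:2309.13590 — 5 statements merged into one kernel-verified Lean document; each statement's English description precedes it below -/
import Mathlib

section
/- Let c be a real number with 0 < c ≤ 1/2. There exists a sequence (a_p), indexed by the prime numbers p, with each a_p an integer satisfying 0 ≤ a_p < p, such that for Lebesgue-almost every x ∈ [0,1], the set of primes p satisfying |x − a_p/p| ≤ c/p is infinite. -/
open MeasureTheory

/-- If finitely many balls `B(a q / q, c / q)` are short in total, and few in number compared to
`p`, then some ball `B(b / p, c / p)` with `0 ≤ b < p` is disjoint from all of them. -/
theorem exists_numerator_disjoint {c : ℝ} (hc0 : 0 ≤ c) (hc : c ≤ 1) {p : ℕ} (hp : 0 < p)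
    (S : Finset ℕ) (a : ℕ → ℕ) (h : ∑ q ∈ S, 2 * c / q + 4 * S.card / p < 1) :
    ∃ b < p, ∀ q ∈ S, Disjoint (Metric.closedBall ((a q : ℝ) / q) (c / q))
      (Metric.closedBall ((b : ℝ) / p) (c / p)) := by
  by_contra! hcon
  have hp' : (0 : ℝ) < p := by exact_mod_cast hp
  have hsub : Set.Ico (0 : ℝ) 1 ⊆
      ⋃ q ∈ S, Metric.closedBall ((a q : ℝ) / q) (c / q + 2 / p) := by
    rintro x ⟨hx0, hx1⟩
    have hxp : 0 ≤ x * p := by positivity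
    obtain ⟨q, hq, hd⟩ := hcon ⌊x * p⌋₊ ((Nat.floor_lt hxp).2 (by nlinarith))
    obtain ⟨y, hy1, hy2⟩ := Set.not_disjoint_iff.1 hd
    have hle : ((⌊x * p⌋₊ : ℕ) : ℝ) / p ≤ x := (div_le_iff₀ hp').2 (Nat.floor_le hxp)
    have hge : x ≤ ((⌊x * p⌋₊ : ℕ) : ℝ) / p + 1 / p := by
      rw [← add_div, le_div_iff₀ hp']
      exact (Nat.lt_floor_add_one _).le
    have hcp : c / p ≤ 1 / p := by gcongr
    have htwo : (2 : ℝ) / p = 1 / p + 1 / p := by ring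
    simp only [Set.mem_iUnion]
    refine ⟨q, hq, ?_⟩
    rw [Metric.mem_closedBall, Real.dist_eq, abs_le] at *
    constructor <;> linarith [hy1.1, hy1.2, hy2.1, hy2.2]
  have hvol := (measure_mono (μ := volume) hsub).trans (measure_biUnion_finset_le _ _)
  simp only [Real.volume_Ico, Real.volume_closedBall] at hvol
  rw [← ENNReal.ofReal_sum_of_nonneg (fun _ _ => by positivity),
    ENNReal.ofReal_le_ofReal_iff (Finset.sum_nonneg fun _ _ => by positivity)] at hvol
  have hsum : ∑ q ∈ S, 2 * (c / (q : ℝ) + 2 / p) = ∑ q ∈ S, 2 * c / (q : ℝ) + 4 * S.card / p := by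
    simp only [mul_add, Finset.sum_add_distrib, Finset.sum_const, nsmul_eq_mul]
    congr 1
    · simp only [mul_div_assoc]
    · ring
  linarith

/-- The primes have density zero. -/
theorem eventually_card_primesBelow_le {ε : ℝ} (hε : 0 < ε) :
    ∀ᶠ n : ℕ in Filter.atTop, (n.primesBelow.card : ℝ) ≤ ε * n := by
  have h1 := Chebyshev.eventually_primeCounting_le one_pos
  have h2 := Real.isLittleO_const_log_atTop (c := Real.log 4 + 1) |>.bound hε
  have h3 := h1.and (h2.and (Filter.eventually_gt_atTop 1))
  filter_upwards [tendsto_natCast_atTop_atTop.eventually h3] with n ⟨h1, h2, hn⟩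
  have hlog : 0 < Real.log n := Real.log_pos hn
  have h4 : 0 ≤ Real.log 4 := Real.log_nonneg (by norm_num)
  rw [Real.norm_of_nonneg (by linarith), Real.norm_of_nonneg hlog.le] at h2
  rw [Nat.floor_natCast] at h1
  rw [Nat.primesBelow_card_eq_primeCounting']
  calc (n.primeCounting' : ℝ) ≤ n.primeCounting := by
        exact_mod_cast Nat.monotone_primeCounting' n.le_succ
    _ ≤ (Real.log 4 + 1) * n / Real.log n := h1
    _ ≤ ε * n := by
        rw [div_le_iff₀ hlog]
        nlinarith

/-- The sum of the reciprocals of the primes in a tail diverges. -/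
theorem exists_le_sum_primes_Ico {c : ℝ} (hc0 : 0 < c) (K : ℕ) (C : ℝ) :
    ∃ n, C ≤ ∑ q ∈ Finset.Ico K n with q.Prime, 2 * c / (q : ℝ) := by
  set f : ℕ → ℝ := Set.indicator {p | p.Prime} (fun n : ℕ => (1 : ℝ) / n) with hf
  have hf0 : ∀ n, 0 ≤ f n := fun n => Set.indicator_nonneg (fun _ _ => by positivity) n
  have ht := (not_summable_iff_tendsto_nat_atTop_of_nonneg hf0).1 not_summable_one_div_on_primes
  obtain ⟨n, hn, hKn⟩ := ((ht.eventually_ge_atTop (C / (2 * c) + ∑ i ∈ Finset.range K, f i)).and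
    (Filter.eventually_ge_atTop K)).exists
  refine ⟨n, ?_⟩
  have hsum : ∑ q ∈ Finset.Ico K n with q.Prime, 2 * c / (q : ℝ) =
      2 * c * ∑ q ∈ Finset.Ico K n, f q := by
    rw [Finset.sum_filter, Finset.mul_sum]
    refine Finset.sum_congr rfl fun q _ => ?_
    by_cases hq : q.Prime <;> simp [hf, hq, div_eq_mul_inv]
  rw [hsum, Finset.sum_Ico_eq_sub _ hKn, mul_comm, ← div_le_iff₀ (by positivity)]
  linarith

/-- Numerators can be chosen so that the balls attached to the primes in an interval `[K, n)` are
pairwise disjoint, as long as their total length stays bounded away from `1`. -/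
theorem exists_numerators_pairwiseDisjoint {c δ : ℝ} (hc0 : 0 ≤ c) (hc : c ≤ 1) {K : ℕ}
    (hK : ∀ p, K ≤ p → (p.primesBelow.card : ℝ) ≤ δ / 4 * p) (n : ℕ)
    (hn : ∀ m < n, ∑ q ∈ Finset.Ico K m with q.Prime, 2 * c / (q : ℝ) < 1 - δ) :
    ∃ a : ℕ → ℕ, (∀ p, p.Prime → a p < p) ∧
      ((Finset.Ico K n).filter Nat.Prime : Set ℕ).PairwiseDisjoint
        (fun q => Metric.closedBall ((a q : ℝ) / q) (c / q)) := by
  induction n with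
  | zero => exact ⟨fun _ => 0, fun p hp => hp.pos, by simp⟩
  | succ n ih =>
    obtain ⟨a, ha, hd⟩ := ih fun m hm => hn m (hm.trans n.lt_succ_self)
    by_cases hnew : K ≤ n ∧ n.Prime
    swap
    · refine ⟨a, ha, hd.subset fun q hq => ?_⟩
      simp only [Finset.coe_filter, Finset.mem_Ico, Set.mem_ofPred_eq] at hq ⊢
      grind
    obtain ⟨hKn, hp⟩ := hnew
    set S := (Finset.Ico K n).filter Nat.Prime with hS
    have hSn : n ∉ S := by simp [hS]
    have hpos : (0 : ℝ) < n := by exact_mod_cast hp.pos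
    have hcard : (S.card : ℝ) ≤ δ / 4 * n := by
      refine le_trans ?_ (hK n hKn)
      exact_mod_cast Finset.card_le_card fun q hq => by
        simp only [hS, Finset.mem_filter, Finset.mem_Ico] at hq
        exact Nat.mem_primesBelow.2 ⟨hq.1.2, hq.2⟩
    have hcard' : 4 * S.card / n ≤ δ := by
      rw [div_le_iff₀ hpos]
      linarith
    obtain ⟨b, hb, hbd⟩ := exists_numerator_disjoint hc0 hc hp.pos S a
      (by linarith [hn n n.lt_succ_self])
    have hins : (Finset.Ico K (n + 1)).filter Nat.Prime = insert n S := by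
      ext q
      simp only [hS, Finset.mem_filter, Finset.mem_Ico, Finset.mem_insert]
      grind
    refine ⟨Function.update a n b, fun p hpp => ?_, ?_⟩
    · rcases eq_or_ne p n with rfl | h
      · simpa using hb
      · simpa [h] using ha p hpp
    · have hne : ∀ q ∈ S, Function.update a n b q = a q := fun q hq =>
        Function.update_of_ne (ne_of_mem_of_not_mem hq hSn) _ _
      rw [hins, Finset.coe_insert]
      refine Set.PairwiseDisjoint.insert (fun q hq r hr hqr => ?_) fun q hq _ => ?_
      · simpa only [Function.onFun, hne q hq, hne r hr] using hd hq hr hqr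
      · simpa only [Function.update_self, hne q hq] using (hbd q hq).symm

/-- Finitely many primes beyond any given bound suffice to cover `[0, 1]` up to measure `ε`. -/
theorem exists_numerators_volume_diff_le {c : ℝ} (hc0 : 0 < c) (hc : c ≤ 1 / 2) (N : ℕ) {ε : ℝ}
    (hε : 0 < ε) :
    ∃ M > N, ∃ a : ℕ → ℕ, (∀ p, p.Prime → a p < p) ∧
      volume (Set.Icc (0 : ℝ) 1 \ ⋃ q ∈ (Finset.Ico N M).filter Nat.Prime,
        Metric.closedBall ((a q : ℝ) / q) (c / q)) ≤ ENNReal.ofReal ε := by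
  obtain ⟨K, hK⟩ := Filter.eventually_atTop.1 <|
    ((eventually_card_primesBelow_le (ε := ε / 2 / 4) (by positivity)).and
      (Filter.eventually_ge_atTop N)).and
      (tendsto_natCast_atTop_atTop.eventually (Filter.eventually_ge_atTop (2 / ε)))
  have hKN : N ≤ K := (hK K le_rfl).1.2
  have hex := exists_le_sum_primes_Ico hc0 K (1 - ε / 2)
  classical
  obtain ⟨a, ha, hd⟩ := exists_numerators_pairwiseDisjoint (δ := ε / 2) hc0.le (by linarith)
    (fun p hp => (hK p hp).1.1) (Nat.find hex) fun m hm => not_le.1 (Nat.find_min hex hm)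
  have hfind := Nat.find_spec hex
  set n := Nat.find hex
  set S := (Finset.Ico K n).filter Nat.Prime with hS
  set U := ⋃ q ∈ S, Metric.closedBall ((a q : ℝ) / q) (c / q) with hU
  have hUm : MeasurableSet U := S.measurableSet_biUnion fun _ _ => measurableSet_closedBall
  have hUvol : volume U = ENNReal.ofReal (∑ q ∈ S, 2 * c / (q : ℝ)) := by
    rw [hU, measure_biUnion_finset hd fun _ _ => measurableSet_closedBall,
      ENNReal.ofReal_sum_of_nonneg fun _ _ => by positivity]
    simp only [Real.volume_closedBall, mul_div_assoc]
  have hUsub : U ⊆ Set.Icc (-(ε / 2)) 1 := by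
    refine Set.iUnion₂_subset fun q hq x hx => ?_
    simp only [hS, Finset.mem_filter, Finset.mem_Ico] at hq
    have hq0 : (0 : ℝ) < q := by exact_mod_cast hq.2.pos
    have hqε : 1 / (q : ℝ) ≤ ε / 2 := by
      have := (hK q hq.1.1).2
      rw [div_le_iff₀ hε] at this
      rw [div_le_iff₀ hq0]
      linarith
    have haq : (a q : ℝ) + 1 ≤ q := by exact_mod_cast ha q hq.2
    have h1 : (a q : ℝ) / q + 1 / q ≤ 1 := by
      rw [← add_div]
      exact div_le_one_of_le₀ haq hq0.le
    have h0 : 0 ≤ (a q : ℝ) / q := by positivity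
    have hcq : c / q ≤ 1 / q := by
      gcongr
      linarith
    rw [Metric.mem_closedBall, Real.dist_eq, abs_le] at hx
    constructor <;> linarith [hx.1, hx.2]
  refine ⟨max n (N + 1), by simp, a, ha, ?_⟩
  calc _ ≤ volume (Set.Icc (-(ε / 2)) 1 \ U) := by
        refine measure_mono (Set.sdiff_subset_sdiff (Set.Icc_subset_Icc_left (by linarith)) ?_)
        refine Set.biUnion_subset_biUnion_left fun q hq => ?_
        simp only [hS, Finset.mem_coe, Finset.mem_filter, Finset.mem_Ico] at hq ⊢
        exact ⟨⟨hKN.trans hq.1.1, hq.1.2.trans_le (le_max_left _ _)⟩, hq.2⟩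
    _ = ENNReal.ofReal (1 + ε / 2 - ∑ q ∈ S, 2 * c / (q : ℝ)) := by
        rw [measure_sdiff hUsub hUm.nullMeasurableSet (by simp [hUvol]), hUvol, Real.volume_Icc,
          ← ENNReal.ofReal_sub _ (Finset.sum_nonneg fun _ _ => by positivity)]
        ring_nf
    _ ≤ ENNReal.ofReal ε := ENNReal.ofReal_le_ofReal (by linarith)

/-- **Rational approximation with chosen numerators.**
For `0 < c ≤ 1/2` there exists a sequence `(a_p)` indexed by the primes, with
`0 ≤ a_p < p`, such that for Lebesgue-almost every `x ∈ [0,1]` the set of primes `p`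
with `|x - a_p/p| ≤ c/p` is infinite. -/
theorem rational_approx_with_chosen_numerators (c : ℝ) (hc0 : 0 < c) (hc : c ≤ 1 / 2) :
    ∃ a : Nat.Primes → ℕ, (∀ p : Nat.Primes, a p < (p : ℕ)) ∧
      ∀ᵐ x ∂(volume.restrict (Set.Icc (0 : ℝ) 1)),
        {p : Nat.Primes | |x - (a p : ℝ) / ((p : ℕ) : ℝ)| ≤ c / ((p : ℕ) : ℝ)}.Infinite := by
  choose M hM A hA hvol using fun N : ℕ =>
    exists_numerators_volume_diff_le hc0 hc N (ε := (1 / 2) ^ N) (by positivity)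
  set t : ℕ → ℕ := fun k => M^[k] 0
  have htsucc : ∀ k, t (k + 1) = M (t k) := fun k => Function.iterate_succ_apply' M k 0
  have htmono : StrictMono t := strictMono_nat_of_lt_succ fun k => htsucc k ▸ hM (t k)
  set block : ℕ → ℕ := fun p => Nat.findGreatest (fun k => t k ≤ p) p
  have hblock : ∀ k p, t k ≤ p → p < t (k + 1) → block p = k := by
    intro k p h1 h2
    refine Nat.findGreatest_eq_iff.2 ⟨htmono.le_apply.trans h1, fun _ => h1, fun m hm _ h => ?_⟩
    exact absurd ((htmono.monotone hm).trans h) h2.not_ge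
  refine ⟨fun p => A (t (block p)) p, fun p => hA _ _ p.2, ?_⟩
  set B : ℕ → Set ℝ := fun k => Set.Icc (0 : ℝ) 1 \
    ⋃ q ∈ (Finset.Ico (t k) (M (t k))).filter Nat.Prime,
      Metric.closedBall ((A (t k) q : ℝ) / q) (c / q) with hB
  have hsum : ∑' k, volume (B k) ≠ ⊤ := by
    refine ne_top_of_le_ne_top ?_ (ENNReal.tsum_le_tsum fun k =>
      (hvol (t k)).trans (ENNReal.ofReal_le_ofReal
        (pow_le_pow_of_le_one (by norm_num) (by norm_num) (htmono.le_apply (x := k)))))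
    rw [← ENNReal.ofReal_tsum_of_nonneg (fun _ => by positivity) summable_geometric_two]
    exact ENNReal.ofReal_ne_top
  rw [ae_restrict_iff' measurableSet_Icc]
  filter_upwards [ae_eventually_notMem hsum] with x hx hx01
  obtain ⟨k₀, hk₀⟩ := Filter.eventually_atTop.1 hx
  refine Set.Infinite.of_image (fun p : Nat.Primes => (p : ℕ)) ?_
  refine Set.infinite_of_not_bddAbove fun ⟨L, hL⟩ => ?_
  have hmem := hk₀ (max k₀ (L + 1)) (le_max_left _ _)
  set k := max k₀ (L + 1)
  simp only [hB, Set.mem_sdiff, hx01, true_and, not_not, Set.mem_iUnion, Finset.mem_filter,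
    Finset.mem_Ico] at hmem
  obtain ⟨q, ⟨⟨h1, h2⟩, hq⟩, hxq⟩ := hmem
  have hqL : q ≤ L := by
    refine hL ⟨⟨q, hq⟩, ?_, rfl⟩
    rw [← htsucc] at h2
    change |x - (A (t (block q)) q : ℝ) / q| ≤ c / q
    rwa [hblock k q h1 h2]
  have hkL : L + 1 ≤ k := le_max_right _ _
  have hkt : k ≤ t k := htmono.le_apply
  omega
end

section
/- Let 0 < c ≤ 1/2 and let 1 ≤ X < Y be real numbers. With notation as in the context, the expectation over a of the Lebesgue measure of Ω_{X,Y}(a) satisfies E(λ(Ω_{X,Y})) ≪ 1/H_{X,Y}, where H_{X,Y} = Σ_{X < p ≤ Y, p prime} 1/p and the implied constant depends only on c. -/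
open MeasureTheory
open scoped ENNReal

/-- The space `𝒜` of sequences `a = (a_p)` indexed by the primes, with `0 ≤ a_p < p`. -/
abbrev PrimeSeq : Type := ∀ p : Nat.Primes, Fin (p : ℕ)

/-- `μ` is the product probability measure on `𝒜` under which the coordinates `a_p` are
independent and each `a_p` is uniformly distributed on `{0, 1, …, p-1}`; this is
characterized by the measures of the cylinder sets. -/
def IsUniformProductMeasure (μ : Measure PrimeSeq) : Prop :=
  IsProbabilityMeasure μ ∧
    ∀ (s : Finset Nat.Primes) (v : PrimeSeq),
      μ {a : PrimeSeq | ∀ p ∈ s, a p = v p} = ∏ p ∈ s, (((p : ℕ) : ℝ≥0∞))⁻¹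

/-- `H_{X,Y} = Σ_{X < p ≤ Y, p prime} 1/p`. -/
noncomputable def Hsum (X Y : ℝ) : ℝ :=
  ∑' p : {p : ℕ // p.Prime ∧ X < (p : ℝ) ∧ (p : ℝ) ≤ Y}, (1 : ℝ) / ((p : ℕ) : ℝ)

/-- The indicator function of the set of reals whose fractional part is less than `c`. -/
noncomputable def fractInd (c t : ℝ) : ℝ := if Int.fract t < c then 1 else 0

lemma fractInd_nonneg (c t : ℝ) : 0 ≤ fractInd c t := by
  unfold fractInd; split_ifs <;> norm_num

lemma fractInd_le_one (c t : ℝ) : fractInd c t ≤ 1 := by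
  unfold fractInd; split_ifs <;> norm_num

lemma measurable_fractInd (c : ℝ) : Measurable (fractInd c) :=
  Measurable.ite (measurableSet_lt measurable_fract measurable_const) measurable_const
    measurable_const

lemma fractInd_periodic (c : ℝ) : Function.Periodic (fractInd c) 1 := by
  intro t
  simp [fractInd, Int.fract_add_one]

lemma intervalIntegrable_of_measurable_of_bound {f : ℝ → ℝ} (hf : Measurable f) {B : ℝ}
    (hB : ∀ t, |f t| ≤ B) (a b : ℝ) : IntervalIntegrable f volume a b := by
  rw [intervalIntegrable_iff]
  exact Measure.integrableOn_of_bounded (M := B) (by simp) hf.aestronglyMeasurable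
    (Filter.Eventually.of_forall hB)

lemma intervalIntegrable_fractInd_comp (c : ℝ) {h : ℝ → ℝ} (hh : Measurable h) (a b : ℝ) :
    IntervalIntegrable (fun t => fractInd c (h t)) volume a b :=
  intervalIntegrable_of_measurable_of_bound ((measurable_fractInd c).comp hh)
    (fun _ => (abs_of_nonneg (fractInd_nonneg c _)).trans_le (fractInd_le_one c _)) a b

lemma intervalIntegrable_fractInd_mul (c : ℝ) {h k : ℝ → ℝ} (hh : Measurable h)
    (hk : Measurable k) (a b : ℝ) :
    IntervalIntegrable (fun t => fractInd c (h t) * fractInd c (k t)) volume a b :=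
  intervalIntegrable_of_measurable_of_bound
    (((measurable_fractInd c).comp hh).mul ((measurable_fractInd c).comp hk)) (B := 1)
    (fun _ => (abs_of_nonneg (mul_nonneg (fractInd_nonneg c _) (fractInd_nonneg c _))).trans_le
      (mul_le_one₀ (fractInd_le_one c _) (fractInd_nonneg c _) (fractInd_le_one c _))) a b

lemma integral_fractInd_mul_eq {c : ℝ} (hc0 : 0 ≤ c) (hc1 : c ≤ 1) {k : ℝ → ℝ}
    (hk : ∀ a b, IntervalIntegrable k volume a b) :
    ∫ t in (0 : ℝ)..1, fractInd c t * k t = ∫ t in (0 : ℝ)..c, k t := by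
  have h1 : Set.EqOn (fun t => fractInd c t * k t) k (Set.Ioo 0 c) := by
    intro _ ht
    have := Int.fract_eq_self.2 ⟨ht.1.le, ht.2.trans_le hc1⟩
    simp [fractInd, this, ht.2]
  have h2 : Set.EqOn (fun t => fractInd c t * k t) (fun _ => 0) (Set.Ioo c 1) := by
    intro _ ht
    have := Int.fract_eq_self.2 ⟨hc0.trans ht.1.le, ht.2⟩
    simp [fractInd, this, ht.1.le]
  have e1 := intervalIntegral.integral_congr_Ioo_of_le (μ := volume) hc0 h1
  have e2 := intervalIntegral.integral_congr_Ioo_of_le (μ := volume) hc1 h2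
  have i1 : IntervalIntegrable (fun t => fractInd c t * k t) volume 0 c :=
    (hk 0 c).congr_uIoo (Set.uIoo_of_le hc0 ▸ h1.symm)
  have i2 : IntervalIntegrable (fun t => fractInd c t * k t) volume c 1 :=
    (intervalIntegrable_const (c := (0 : ℝ))).congr_uIoo (Set.uIoo_of_le hc1 ▸ h2.symm)
  rw [← intervalIntegral.integral_add_adjacent_intervals i1 i2, e1, e2]
  simp

lemma integral_fractInd {c : ℝ} (hc0 : 0 ≤ c) (hc1 : c ≤ 1) :
    ∫ t in (0 : ℝ)..1, fractInd c t = c := by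
  have := integral_fractInd_mul_eq hc0 hc1 (k := fun _ => 1) (fun a b => intervalIntegrable_const)
  simpa using this

lemma integral_fractInd_add_nat {c : ℝ} (hc0 : 0 ≤ c) (hc1 : c ≤ 1) (b : ℝ) (n : ℕ) :
    ∫ t in b..(b + n), fractInd c t = n * c := by
  have h := (fractInd_periodic c).intervalIntegral_add_zsmul_eq n b
    (fun a b => intervalIntegrable_fractInd_comp c measurable_id a b)
  have h' := (fractInd_periodic c).intervalIntegral_add_eq b 0
  simp only [zsmul_eq_mul, mul_one, Int.cast_natCast, zero_add] at h h'
  rw [h, h', integral_fractInd hc0 hc1]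

lemma integral_fractInd_le {c : ℝ} (hc0 : 0 ≤ c) (hc1 : c ≤ 1) (b : ℝ) {l : ℝ} (hl : 0 ≤ l) :
    ∫ t in b..(b + l), fractInd c t ≤ (l + 1) * c := by
  calc ∫ t in b..(b + l), fractInd c t
      ≤ ∫ t in b..(b + ⌈l⌉₊), fractInd c t := by
        apply intervalIntegral.integral_mono_interval le_rfl (by linarith)
          (by linarith [Nat.le_ceil l])
          (Filter.Eventually.of_forall fun t => fractInd_nonneg c t)
          (intervalIntegrable_fractInd_comp c measurable_id _ _)
    _ = ⌈l⌉₊ * c := integral_fractInd_add_nat hc0 hc1 b _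
    _ ≤ (l + 1) * c := by gcongr; exact (Nat.ceil_lt_add_one hl).le

lemma integral_fractInd_nat_mul {c : ℝ} (hc0 : 0 ≤ c) (hc1 : c ≤ 1) {n : ℕ} (hn : n ≠ 0) :
    ∫ x in (0 : ℝ)..1, fractInd c (n * x) = c := by
  have hn' : (n : ℝ) ≠ 0 := by exact_mod_cast hn
  rw [intervalIntegral.integral_comp_mul_left _ hn']
  have := integral_fractInd_add_nat hc0 hc1 0 n
  simp only [zero_add] at this
  simp [this, hn']

lemma integral_fractInd_mul_shift_le {c : ℝ} (hc0 : 0 ≤ c) (hc1 : c ≤ 1) {r : ℝ} (hr : 0 < r)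
    (a : ℕ) :
    ∫ t in (a : ℝ)..((a + 1 : ℕ) : ℝ), fractInd c t * fractInd c (r * t) ≤ c ^ 2 + c / r := by
  have h := intervalIntegral.integral_comp_add_right (a := 0) (b := 1)
    (fun t => fractInd c t * fractInd c (r * t)) (a : ℝ)
  have hs : ∀ t, fractInd c (t + a) = fractInd c t := by
    intro t
    simpa using (fractInd_periodic c).nat_mul a t
  simp only [hs, zero_add] at h
  push_cast
  rw [add_comm (a : ℝ) 1, ← h, integral_fractInd_mul_eq hc0 hc1
    (fun _ _ => intervalIntegrable_fractInd_comp c (by fun_prop) _ _)]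
  simp only [mul_add]
  rw [intervalIntegral.integral_comp_mul_add _ hr.ne']
  have := integral_fractInd_le hc0 hc1 (r * a) (mul_nonneg hr.le hc0)
  rw [mul_zero, zero_add, add_comm (r * c), smul_eq_mul]
  calc r⁻¹ * _ ≤ r⁻¹ * ((r * c + 1) * c) := by gcongr
    _ = c ^ 2 + c / r := by field_simp

lemma integral_fractInd_mul_le {c : ℝ} (hc0 : 0 ≤ c) (hc1 : c ≤ 1) {m n : ℕ} (hm : m ≠ 0)
    (hn : n ≠ 0) :
    ∫ x in (0 : ℝ)..1, fractInd c (m * x) * fractInd c (n * x) ≤ c ^ 2 + c * m / n := by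
  have hm' : (0 : ℝ) < m := by exact_mod_cast Nat.pos_of_ne_zero hm
  have hn' : (0 : ℝ) < n := by exact_mod_cast Nat.pos_of_ne_zero hn
  have h := intervalIntegral.integral_comp_mul_left (a := 0) (b := 1)
    (fun t => fractInd c t * fractInd c (n / m * t)) hm'.ne'
  have e : ∀ x : ℝ, (n : ℝ) / m * (m * x) = n * x := fun x => by field_simp
  simp only [e, mul_zero, mul_one] at h
  rw [h, smul_eq_mul]
  have hsum := intervalIntegral.sum_integral_adjacent_intervals (μ := volume)
    (f := fun t => fractInd c t * fractInd c (n / m * t)) (a := fun k : ℕ => (k : ℝ)) (n := m)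
    (fun k _ => intervalIntegrable_fractInd_mul c measurable_id (by fun_prop) _ _)
  simp only [Nat.cast_zero] at hsum
  rw [← hsum]
  calc (m : ℝ)⁻¹ * _ ≤ (m : ℝ)⁻¹ * ∑ _k ∈ Finset.range m, (c ^ 2 + c / (n / m)) := by
        gcongr with k
        exact integral_fractInd_mul_shift_le hc0 hc1 (by positivity) k
    _ = c ^ 2 + c * m / n := by
        simp only [Finset.sum_const, Finset.card_range, nsmul_eq_mul]
        field_simp

/-- The weighted count `∑ 1/n` of those `n ∈ N` for which the fractional part of `n x` is less
than `c`. -/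
noncomputable def hitSum (N : Finset ℕ) (c x : ℝ) : ℝ := ∑ n ∈ N, fractInd c (n * x) / n

lemma hitSum_nonneg (N : Finset ℕ) (c x : ℝ) : 0 ≤ hitSum N c x :=
  Finset.sum_nonneg fun _ _ => div_nonneg (fractInd_nonneg _ _) (Nat.cast_nonneg _)

lemma measurable_hitSum (N : Finset ℕ) (c : ℝ) : Measurable (hitSum N c) := by
  unfold hitSum
  exact Finset.measurable_sum _ fun n _ =>
    ((measurable_fractInd c).comp (by fun_prop)).div_const _

lemma integral_hitSum {N : Finset ℕ} (hN : 0 ∉ N) {c : ℝ} (hc0 : 0 ≤ c) (hc1 : c ≤ 1) :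
    ∫ x in (0 : ℝ)..1, hitSum N c x = c * ∑ n ∈ N, (1 : ℝ) / n := by
  unfold hitSum
  rw [intervalIntegral.integral_finsetSum fun n _ =>
    (intervalIntegrable_fractInd_comp c (by fun_prop) _ _).div_const _, Finset.mul_sum]
  refine Finset.sum_congr rfl fun n hn => ?_
  rw [intervalIntegral.integral_div, integral_fractInd_nat_mul hc0 hc1 (by rintro rfl; exact hN hn)]
  ring

lemma sum_sum_min_div_max_le {N : Finset ℕ} (hN : 0 ∉ N) :
    ∑ m ∈ N, ∑ n ∈ N, ((min m n : ℕ) / (max m n : ℕ) : ℝ) / (m * n) ≤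
      2 * ∑ n ∈ N, (1 : ℝ) / n := by
  have key : ∀ n ∈ N, ∑ m ∈ N, (if m ≤ n then (1 : ℝ) / n ^ 2 else 0) ≤ 1 / n := by
    intro n hn
    have hn0 : (0 : ℝ) < n := by
      exact_mod_cast Nat.pos_of_ne_zero (by rintro rfl; exact hN hn)
    rw [← Finset.sum_filter, Finset.sum_const, nsmul_eq_mul]
    have hcard : (N.filter (· ≤ n)).card ≤ n := by
      calc _ ≤ (Finset.Icc 1 n).card := by
            apply Finset.card_le_card
            intro m hm
            rw [Finset.mem_filter] at hm
            exact Finset.mem_Icc.2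
              ⟨Nat.pos_of_ne_zero (by rintro rfl; exact hN hm.1), hm.2⟩
        _ = n := by simp
    have : ((N.filter (· ≤ n)).card : ℝ) ≤ n := by exact_mod_cast hcard
    calc _ ≤ (n : ℝ) * (1 / n ^ 2) := by gcongr
      _ = 1 / n := by field_simp
  calc _ ≤ ∑ m ∈ N, ∑ n ∈ N, ((if m ≤ n then (1 : ℝ) / n ^ 2 else 0) +
          (if n ≤ m then (1 : ℝ) / m ^ 2 else 0)) := by
        refine Finset.sum_le_sum fun m hm => Finset.sum_le_sum fun n hn => ?_
        have hm0 : (0 : ℝ) < m := by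
          exact_mod_cast Nat.pos_of_ne_zero (by rintro rfl; exact hN hm)
        have hn0 : (0 : ℝ) < n := by
          exact_mod_cast Nat.pos_of_ne_zero (by rintro rfl; exact hN hn)
        rcases le_total m n with h | h
        · rw [min_eq_left h, max_eq_right h, if_pos h]
          have : (m / n : ℝ) / (m * n) = 1 / n ^ 2 := by field_simp
          rw [this]
          exact le_add_of_nonneg_right (by split_ifs <;> positivity)
        · rw [min_eq_right h, max_eq_left h, if_pos h]
          have : (n / m : ℝ) / (m * n) = 1 / m ^ 2 := by field_simp
          rw [this]
          exact le_add_of_nonneg_left (by split_ifs <;> positivity)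
    _ = ∑ n ∈ N, ∑ m ∈ N, (if m ≤ n then (1 : ℝ) / n ^ 2 else 0) +
          ∑ m ∈ N, ∑ n ∈ N, (if n ≤ m then (1 : ℝ) / m ^ 2 else 0) := by
        simp only [Finset.sum_add_distrib]
        rw [Finset.sum_comm]
    _ ≤ ∑ n ∈ N, (1 : ℝ) / n + ∑ n ∈ N, (1 : ℝ) / n :=
        add_le_add (Finset.sum_le_sum key) (Finset.sum_le_sum key)
    _ = _ := by ring

lemma integral_hitSum_sq_le {N : Finset ℕ} (hN : 0 ∉ N) {c : ℝ} (hc0 : 0 ≤ c) (hc1 : c ≤ 1) :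
    ∫ x in (0 : ℝ)..1, hitSum N c x ^ 2 ≤
      (c * ∑ n ∈ N, (1 : ℝ) / n) ^ 2 + 2 * c * ∑ n ∈ N, (1 : ℝ) / n := by
  have hsq : ∀ x, hitSum N c x ^ 2 =
      ∑ m ∈ N, ∑ n ∈ N, fractInd c (m * x) * fractInd c (n * x) / (m * n) := by
    intro x
    rw [hitSum, sq, Finset.sum_mul_sum]
    exact Finset.sum_congr rfl fun m _ => Finset.sum_congr rfl fun n _ => div_mul_div_comm ..
  have hint : ∀ m n : ℕ, IntervalIntegrable
      (fun x => fractInd c (m * x) * fractInd c (n * x) / (m * n)) volume 0 1 := fun m n =>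
    (intervalIntegrable_fractInd_mul c (by fun_prop) (by fun_prop) _ _).div_const _
  simp only [hsq]
  rw [intervalIntegral.integral_finsetSum fun m _ => by
    simpa only [Finset.sum_fn] using IntervalIntegrable.sum N fun n _ => hint m n]
  calc _ ≤ ∑ m ∈ N, ∑ n ∈ N,
        (c ^ 2 + c * ((min m n : ℕ) / (max m n : ℕ) : ℝ)) / (m * n) := by
        refine Finset.sum_le_sum fun m hm => ?_
        rw [intervalIntegral.integral_finsetSum fun n _ => hint m n]
        refine Finset.sum_le_sum fun n hn => ?_
        have hm0 : m ≠ 0 := by rintro rfl; exact hN hm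
        have hn0 : n ≠ 0 := by rintro rfl; exact hN hn
        rw [intervalIntegral.integral_div]
        gcongr
        rcases le_total m n with h | h
        · rw [min_eq_left h, max_eq_right h, ← mul_div_assoc]
          exact integral_fractInd_mul_le hc0 hc1 hm0 hn0
        · rw [min_eq_right h, max_eq_left h, ← mul_div_assoc]
          simp only [mul_comm (fractInd c (m * _))]
          exact integral_fractInd_mul_le hc0 hc1 hn0 hm0
    _ = (c * ∑ n ∈ N, (1 : ℝ) / n) ^ 2 +
        c * ∑ m ∈ N, ∑ n ∈ N, ((min m n : ℕ) / (max m n : ℕ) : ℝ) / (m * n) := by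
        rw [mul_pow, sq (∑ n ∈ N, (1 : ℝ) / n), Finset.sum_mul_sum]
        simp only [Finset.mul_sum, ← Finset.sum_add_distrib]
        refine Finset.sum_congr rfl fun m _ => Finset.sum_congr rfl fun n _ => ?_
        rw [add_div, div_mul_div_comm, one_mul, mul_one_div, mul_div_assoc c]
    _ ≤ _ := by
        have := mul_le_mul_of_nonneg_left (sum_sum_min_div_max_le hN) hc0
        linarith

lemma exp_neg_le_quadratic {M s : ℝ} (hM : 0 < M) (hs0 : 0 ≤ s) :
    Real.exp (-s) ≤ 4 * (s - M) ^ 2 / M ^ 2 + 2 / M := by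
  rcases le_total s (M / 2) with hs | hs
  · have h1 : Real.exp (-s) ≤ 1 := Real.exp_le_one_iff.2 (by linarith)
    have h2 : 1 ≤ 4 * (s - M) ^ 2 / M ^ 2 := by
      rw [one_le_div (by positivity)]
      nlinarith
    have : 0 < 2 / M := by positivity
    linarith
  · have h1 : Real.exp (-s) ≤ 2 / M := by
      rw [Real.exp_neg, inv_le_comm₀ (Real.exp_pos _) (by positivity), inv_div]
      linarith [Real.add_one_le_exp s]
    have : 0 ≤ 4 * (s - M) ^ 2 / M ^ 2 := by positivity
    linarith

lemma integral_exp_neg_hitSum_le {N : Finset ℕ} (hN : 0 ∉ N) {c : ℝ} (hc0 : 0 < c) (hc1 : c ≤ 1)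
    (hH : 0 < ∑ n ∈ N, (1 : ℝ) / n) :
    ∫ x in (0 : ℝ)..1, Real.exp (-hitSum N c x) ≤ 10 / c / ∑ n ∈ N, (1 : ℝ) / n := by
  set H := ∑ n ∈ N, (1 : ℝ) / n with hHdef
  have hM : 0 < c * H := mul_pos hc0 hH
  have hbound : ∀ x, |hitSum N c x| ≤ H := fun x => by
    rw [abs_of_nonneg (hitSum_nonneg _ _ _)]
    exact Finset.sum_le_sum fun n _ =>
      div_le_div_of_nonneg_right (fractInd_le_one _ _) (Nat.cast_nonneg _)
  have hmeas := measurable_hitSum N c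
  have i1 : IntervalIntegrable (hitSum N c) volume 0 1 :=
    intervalIntegrable_of_measurable_of_bound hmeas hbound _ _
  have i2 : IntervalIntegrable (fun x => hitSum N c x ^ 2) volume 0 1 :=
    intervalIntegrable_of_measurable_of_bound (hmeas.pow_const 2) (B := H ^ 2) (fun x => by
      rw [abs_pow]; exact pow_le_pow_left₀ (abs_nonneg _) (hbound x) 2) _ _
  have i3 : IntervalIntegrable (fun x => Real.exp (-hitSum N c x)) volume 0 1 :=
    intervalIntegrable_of_measurable_of_bound (by fun_prop) (B := 1) (fun x => by
      rw [abs_of_pos (Real.exp_pos _), Real.exp_le_one_iff]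
      linarith [hitSum_nonneg N c x]) _ _
  have i4 : IntervalIntegrable (fun x => 4 / (c * H) ^ 2 * hitSum N c x ^ 2
      - 8 / (c * H) * hitSum N c x + (4 + 2 / (c * H))) volume 0 1 :=
    ((i2.const_mul _).sub (i1.const_mul _)).add intervalIntegrable_const
  calc ∫ x in (0 : ℝ)..1, Real.exp (-hitSum N c x)
      ≤ ∫ x in (0 : ℝ)..1, (4 / (c * H) ^ 2 * hitSum N c x ^ 2
          - 8 / (c * H) * hitSum N c x + (4 + 2 / (c * H))) := by
        refine intervalIntegral.integral_mono zero_le_one i3 i4 fun x => ?_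
        refine (exp_neg_le_quadratic hM (hitSum_nonneg N c x)).trans_eq ?_
        field_simp
        ring
    _ = 4 / (c * H) ^ 2 * (∫ x in (0 : ℝ)..1, hitSum N c x ^ 2)
          - 8 / (c * H) * (c * H) + (4 + 2 / (c * H)) := by
        rw [intervalIntegral.integral_add ((i2.const_mul _).sub (i1.const_mul _))
          intervalIntegrable_const, intervalIntegral.integral_sub (i2.const_mul _)
          (i1.const_mul _), intervalIntegral.integral_const_mul,
          intervalIntegral.integral_const_mul, integral_hitSum hN hc0.le hc1,
          ← hHdef, intervalIntegral.integral_const, sub_zero, one_smul]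
    _ ≤ 4 / (c * H) ^ 2 * ((c * H) ^ 2 + 2 * c * H) - 8 / (c * H) * (c * H)
          + (4 + 2 / (c * H)) := by
        gcongr
        exact integral_hitSum_sq_le hN hc0.le hc1
    _ = 10 / c / H := by
        field_simp
        ring

lemma measurableSet_forall_mem_eq_and_ne (s t : Finset Nat.Primes) (v : PrimeSeq) :
    MeasurableSet {a : PrimeSeq | (∀ p ∈ s, a p = v p) ∧ ∀ p ∈ t, a p ≠ v p} := by
  have h : ∀ p, MeasurableSet {a : PrimeSeq | a p = v p} := fun p =>
    (measurable_pi_apply p : Measurable fun a : PrimeSeq => a p) (measurableSet_singleton (v p))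
  simp only [Set.ofPred_and, Set.ofPred_forall]
  exact (MeasurableSet.iInter fun p => .iInter fun _ => h p).inter
    (MeasurableSet.iInter fun p => .iInter fun _ => (h p).compl)

lemma measureReal_forall_mem_eq_and_ne {μ : Measure PrimeSeq} (hμ : IsUniformProductMeasure μ)
    (v : PrimeSeq) (s t : Finset Nat.Primes) (hst : Disjoint s t) :
    μ.real {a : PrimeSeq | (∀ p ∈ s, a p = v p) ∧ ∀ p ∈ t, a p ≠ v p} =
      (∏ p ∈ s, (1 / (p : ℕ) : ℝ)) * ∏ p ∈ t, (1 - 1 / (p : ℕ) : ℝ) := by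
  have := hμ.1
  classical
  induction t using Finset.induction_on generalizing s with
  | empty =>
    simp [Measure.real, hμ.2 s v, ENNReal.toReal_prod]
  | insert q t hq ih =>
    rw [Finset.disjoint_insert_right] at hst
    have hdiff : {a : PrimeSeq | (∀ p ∈ s, a p = v p) ∧ ∀ p ∈ insert q t, a p ≠ v p} =
        {a | (∀ p ∈ s, a p = v p) ∧ ∀ p ∈ t, a p ≠ v p} \
          {a | (∀ p ∈ insert q s, a p = v p) ∧ ∀ p ∈ t, a p ≠ v p} := by
      ext a
      simp only [Finset.forall_mem_insert, Set.mem_sdiff, Set.mem_ofPred_eq]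
      tauto
    rw [hdiff, measureReal_sdiff _ (measurableSet_forall_mem_eq_and_ne _ _ _), ih s hst.2,
      ih (insert q s) (Finset.disjoint_insert_left.2 ⟨hq, hst.2⟩), Finset.prod_insert hst.1,
      Finset.prod_insert hq]
    · ring
    · intro a
      simp only [Finset.forall_mem_insert, Set.mem_ofPred_eq]
      tauto

lemma measure_forall_lt_abs_sub_le {μ : Measure PrimeSeq} (hμ : IsUniformProductMeasure μ)
    {c : ℝ} (s : Finset Nat.Primes) {x : ℝ} (hx : x ∈ Set.Ico (0 : ℝ) 1) :
    μ {a : PrimeSeq | ∀ p ∈ s, c / ((p : ℕ) : ℝ) < |x - ((a p : ℕ) : ℝ) / ((p : ℕ) : ℝ)|} ≤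
      ENNReal.ofReal (Real.exp (-∑ p ∈ s, fractInd c ((p : ℕ) * x) / (p : ℕ))) := by
  have := hμ.1
  have hp0 : ∀ p : Nat.Primes, (0 : ℝ) < (p : ℕ) := fun p => by exact_mod_cast p.2.pos
  have hlt : ∀ p : Nat.Primes, ⌊((p : ℕ) : ℝ) * x⌋₊ < p := fun p => by
    rw [Nat.floor_lt (mul_nonneg (hp0 p).le hx.1)]
    exact mul_lt_of_lt_one_right (hp0 p) hx.2
  set v : PrimeSeq := fun p => ⟨⌊((p : ℕ) : ℝ) * x⌋₊, hlt p⟩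
  set t := s.filter fun p : Nat.Primes => Int.fract (((p : ℕ) : ℝ) * x) < c with ht
  have hsub : {a : PrimeSeq | ∀ p ∈ s,
      c / ((p : ℕ) : ℝ) < |x - ((a p : ℕ) : ℝ) / ((p : ℕ) : ℝ)|} ⊆
      {a | (∀ p ∈ (∅ : Finset Nat.Primes), a p = v p) ∧ ∀ p ∈ t, a p ≠ v p} := by
    intro a ha
    refine ⟨by simp, fun p hp hav => ?_⟩
    rw [ht, Finset.mem_filter] at hp
    have h := ha p hp.1
    have hfl : ((v p : ℕ) : ℝ) = (p : ℕ) * x - Int.fract (((p : ℕ) : ℝ) * x) := by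
      rw [Int.self_sub_fract, ← natCast_floor_eq_intCast_floor (mul_nonneg (hp0 p).le hx.1)]
    have he : x - ((p : ℕ) * x - Int.fract (((p : ℕ) : ℝ) * x)) / (p : ℕ) =
        Int.fract (((p : ℕ) : ℝ) * x) / (p : ℕ) := by
      have := (hp0 p).ne'
      field_simp
      ring
    rw [hav, hfl, he, abs_of_nonneg (div_nonneg (Int.fract_nonneg _) (hp0 p).le),
      div_lt_div_iff_of_pos_right (hp0 p)] at h
    exact lt_asymm h hp.2
  refine (measure_mono hsub).trans ?_
  rw [← ofReal_measureReal, measureReal_forall_mem_eq_and_ne hμ v ∅ t (by simp)]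
  refine ENNReal.ofReal_le_ofReal ?_
  have hS : ∑ p ∈ s, fractInd c ((p : ℕ) * x) / (p : ℕ) = ∑ p ∈ t, (1 / (p : ℕ) : ℝ) := by
    rw [ht, Finset.sum_filter]
    refine Finset.sum_congr rfl fun p _ => ?_
    unfold fractInd
    split_ifs <;> simp
  rw [hS, ← Finset.sum_neg_distrib, Real.exp_sum, Finset.prod_empty, one_mul]
  refine Finset.prod_le_prod (fun p _ => ?_) fun p _ => ?_
  · rw [sub_nonneg, div_le_one (hp0 p)]
    exact_mod_cast p.2.one_le
  · linarith [Real.add_one_le_exp (-(1 / (p : ℕ) : ℝ))]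

lemma measurableSet_forall_lt_abs_sub (c : ℝ) (s : Finset Nat.Primes) :
    MeasurableSet {z : PrimeSeq × ℝ | ∀ p ∈ s,
      c / ((p : ℕ) : ℝ) < |z.2 - ((z.1 p : ℕ) : ℝ) / ((p : ℕ) : ℝ)|} := by
  simp only [Set.ofPred_forall]
  refine .iInter fun p => .iInter fun _ => measurableSet_lt measurable_const ?_
  have h : Measurable fun z : PrimeSeq × ℝ => ((z.1 p : ℕ) : ℝ) :=
    (measurable_from_top (f := fun i : Fin (p : ℕ) => ((i : ℕ) : ℝ))).comp
      ((measurable_pi_apply p).comp measurable_fst)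
  exact (measurable_snd.sub (h.div_const _)).abs

lemma lintegral_measure_forall_lt_abs_sub_le {μ : Measure PrimeSeq}
    (hμ : IsUniformProductMeasure μ) {c : ℝ} (s : Finset Nat.Primes) :
    ∫⁻ a : PrimeSeq, (volume.restrict (Set.Icc (0 : ℝ) 1)) {x : ℝ | ∀ p ∈ s,
        c / ((p : ℕ) : ℝ) < |x - ((a p : ℕ) : ℝ) / ((p : ℕ) : ℝ)|} ∂μ ≤
      ENNReal.ofReal (∫ x in (0 : ℝ)..1,
        Real.exp (-∑ p ∈ s, fractInd c ((p : ℕ) * x) / (p : ℕ))) := by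
  have := hμ.1
  have hA := measurableSet_forall_lt_abs_sub c s
  have h1 := Measure.prod_apply (μ := μ) (ν := volume.restrict (Set.Icc (0 : ℝ) 1)) hA
  have h2 := Measure.prod_apply_symm (μ := μ) (ν := volume.restrict (Set.Icc (0 : ℝ) 1)) hA
  refine (h1.symm.trans h2).trans_le ?_
  have hmeas : Measurable fun x : ℝ =>
      Real.exp (-∑ p ∈ s, fractInd c ((p : ℕ) * x) / (p : ℕ)) :=
    Real.measurable_exp.comp (measurable_neg.comp (Finset.measurable_fun_sum _ fun p _ =>
      ((measurable_fractInd c).comp (measurable_const_mul ((p : ℕ) : ℝ))).div_const _))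
  have hint := intervalIntegrable_of_measurable_of_bound hmeas (B := 1) (fun x => by
    rw [abs_of_pos (Real.exp_pos _), Real.exp_le_one_iff, neg_nonpos]
    exact Finset.sum_nonneg fun p _ => div_nonneg (fractInd_nonneg _ _) (Nat.cast_nonneg _)) 0 1
  rw [intervalIntegral.integral_of_le zero_le_one, ← restrict_Ico_eq_restrict_Ioc,
    ofReal_integral_eq_lintegral_ofReal, ← restrict_Ico_eq_restrict_Icc]
  · exact setLIntegral_mono' measurableSet_Ico fun x hx => measure_forall_lt_abs_sub_le hμ s hx
  · rw [restrict_Ico_eq_restrict_Ioc]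
    exact (intervalIntegrable_iff_integrableOn_Ioc_of_le zero_le_one).1 hint
  · exact Filter.Eventually.of_forall fun x => (Real.exp_pos _).le

lemma exists_finset_primes_mem_iff (X Y : ℝ) :
    ∃ s : Finset Nat.Primes, (∀ p : Nat.Primes, p ∈ s ↔ X < ((p : ℕ) : ℝ) ∧ ((p : ℕ) : ℝ) ≤ Y) ∧
      ∃ N : Finset ℕ, 0 ∉ N ∧ Hsum X Y = ∑ n ∈ N, (1 : ℝ) / n ∧
        ∀ f : ℕ → ℝ, ∑ p ∈ s, f p = ∑ n ∈ N, f n := by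
  classical
  set N := (Finset.range (⌊Y⌋₊ + 1)).filter fun p : ℕ => p.Prime ∧ X < (p : ℝ) ∧ (p : ℝ) ≤ Y
    with hN
  have hmem : ∀ p : ℕ, p ∈ N ↔ p.Prime ∧ X < (p : ℝ) ∧ (p : ℝ) ≤ Y := fun p => by
    rw [hN, Finset.mem_filter, Finset.mem_range, Nat.lt_succ_iff, and_iff_right_iff_imp]
    exact fun h => Nat.le_floor h.2.2
  refine ⟨N.subtype Nat.Prime, fun p => ?_, N, fun h => Nat.not_prime_zero ((hmem 0).1 h).1, ?_,
    fun f => Finset.sum_subtype_of_mem f fun p hp => ((hmem p).1 hp).1⟩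
  · exact Finset.mem_subtype.trans ((hmem p).trans (and_iff_right p.2))
  · rw [Hsum, ← Finset.tsum_subtype N fun n => (1 : ℝ) / n]
    exact ((Equiv.subtypeEquivRight hmem).tsum_eq
      fun p : {p : ℕ // p.Prime ∧ X < (p : ℝ) ∧ (p : ℝ) ≤ Y} => (1 : ℝ) / ((p : ℕ) : ℝ)).symm

/-- For `0 < c ≤ 1/2` there is a constant `C` (depending only on `c`) such that for all
reals `1 ≤ X < Y`, the expectation over `a ∈ 𝒜` of the Lebesgue measure of
`Ω_{X,Y}(a) = {x ∈ [0,1] : |x - a_p/p| > c/p for all primes X < p ≤ Y}` is at most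
`C / H_{X,Y}`. -/
theorem expected_measure_Omega_le (c : ℝ) (hc0 : 0 < c) (hc : c ≤ 1 / 2) :
    ∃ C : ℝ≥0∞, 0 < C ∧ C < ⊤ ∧
      ∀ (μ : Measure PrimeSeq), IsUniformProductMeasure μ →
        ∀ X Y : ℝ, 1 ≤ X → X < Y →
          (∫⁻ a : PrimeSeq,
              (volume.restrict (Set.Icc (0 : ℝ) 1))
                {x : ℝ | ∀ p : Nat.Primes, X < ((p : ℕ) : ℝ) → ((p : ℕ) : ℝ) ≤ Y →
                  c / ((p : ℕ) : ℝ) < |x - ((a p : ℕ) : ℝ) / ((p : ℕ) : ℝ)|} ∂μ)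
            ≤ C / ENNReal.ofReal (Hsum X Y) := by
  have hC : 0 < ENNReal.ofReal (10 / c) := ENNReal.ofReal_pos.2 (by positivity)
  refine ⟨ENNReal.ofReal (10 / c), hC, ENNReal.ofReal_lt_top, fun μ hμ X Y _ _ => ?_⟩
  obtain ⟨s, hs, N, hN, hH, hsum⟩ := exists_finset_primes_mem_iff X Y
  rcases le_or_gt (Hsum X Y) 0 with h0 | h0
  · rw [ENNReal.ofReal_of_nonpos h0, ENNReal.div_zero hC.ne']
    exact le_top
  have h := lintegral_measure_forall_lt_abs_sub_le hμ (c := c) s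
  have he : ∀ x : ℝ, ∑ p ∈ s, fractInd c ((p : ℕ) * x) / (p : ℕ) = hitSum N c x := fun x =>
    hsum fun n => fractInd c (n * x) / n
  simp only [hs, and_imp, he] at h
  refine h.trans ?_
  rw [← ENNReal.ofReal_div_of_pos h0]
  refine ENNReal.ofReal_le_ofReal ?_
  rw [hH] at h0 ⊢
  exact integral_exp_neg_hitSum_le hN hc0 (by linarith) h0
end

section
/- Let 0 < c ≤ 1/2. For every real X ≥ 2 and every ε > 0 there exists a real Y > X and a choice of integers a_p with 0 ≤ a_p < p for each prime p with X < p ≤ Y, such that the Lebesgue measure of the set { x ∈ [0,1] : |x − a_p/p| ≤ c/p for some prime p with X < p ≤ Y } is at least 1 − ε. -/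
open MeasureTheory

open Filter Set Topology

/-- Moving a measurable set of finite measure by a small translation changes it little. -/
lemma tendsto_volume_diff_preimage_sub {E : Set ℝ} (hE : MeasurableSet E)
    (hEfin : volume E ≠ ⊤) :
    Tendsto (fun t : ℝ ↦ volume (E \ ((fun x ↦ x - t) ⁻¹' E))) (𝓝 0) (𝓝 0) := by
  let F : C(ℝ, C(ℝ, ℝ)) := ContinuousMap.curry ⟨fun q : ℝ × ℝ ↦ q.2 - q.1, by fun_prop⟩
  have key := tendsto_measure_symmDiff_preimage_nhds_zero (μ := volume) (ν := volume)
    (F.continuous.tendsto 0)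
    (Eventually.of_forall fun t ↦ measurePreserving_sub_right volume t)
    (measurePreserving_sub_right volume 0) hE.nullMeasurableSet hEfin
  refine tendsto_of_tendsto_of_tendsto_of_le_of_le tendsto_const_nhds key
    (fun _ ↦ zero_le) fun t ↦ measure_mono fun x hx ↦ Or.inr ⟨?_, hx.2⟩
  simpa [F] using hx.1

/-- Boundedly many translates by multiples of `2 * c / n` of the `c / n`-neighbourhood of the
fractions `a / n`, `0 ≤ a < n`, cover the unit interval. -/
lemma exists_sub_mem_iUnion_closedBall {c : ℝ} (hc : 0 < c) {n : ℕ} (hn : 0 < n) {x : ℝ}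
    (hx : x ∈ Icc (0 : ℝ) 1) :
    ∃ j ∈ Finset.range (⌊1 / (2 * c) + 1 / 2⌋₊ + 1),
      x - 2 * c * j / n ∈ ⋃ a ∈ Finset.range n, Metric.closedBall ((a : ℝ) / n) (c / n) := by
  have hn' : (0 : ℝ) < n := by exact_mod_cast hn
  obtain ⟨a, han, ha0, ha1⟩ : ∃ a < n, (a : ℝ) ≤ n * x ∧ n * x ≤ a + 1 := by
    rcases hx.2.lt_or_eq with h | h
    · refine ⟨⌊n * x⌋₊, ?_, Nat.floor_le (mul_nonneg hn'.le hx.1), (Nat.lt_floor_add_one _).le⟩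
      rw [Nat.floor_lt (mul_nonneg hn'.le hx.1)]
      nlinarith
    · refine ⟨n - 1, by omega, ?_, ?_⟩ <;> rw [Nat.cast_sub hn, h] <;> simp
  set y : ℝ := n * x - a with hy
  have hy0 : 0 ≤ y / (2 * c) := div_nonneg (by linarith) (by linarith)
  refine ⟨⌊y / (2 * c) + 1 / 2⌋₊, ?_, ?_⟩
  · rw [Finset.mem_range, Nat.lt_succ_iff]
    gcongr
    linarith
  · simp only [mem_iUnion]
    refine ⟨a, Finset.mem_range.2 han, ?_⟩
    set j := ⌊y / (2 * c) + 1 / 2⌋₊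
    have h1 : (j : ℝ) ≤ y / (2 * c) + 1 / 2 := Nat.floor_le (by positivity)
    have h2 : y / (2 * c) + 1 / 2 < j + 1 := Nat.lt_floor_add_one _
    have hyc : y / (2 * c) * (2 * c) = y := by field_simp
    have h3 : |y - 2 * c * j| ≤ c := by
      rw [abs_le]
      constructor <;> nlinarith
    rw [Metric.mem_closedBall, Real.dist_eq,
      show x - 2 * c * j / n - a / n = (y - 2 * c * j) / n by rw [hy]; field_simp; ring,
      abs_div, abs_of_pos hn']
    gcongr

/-- A set of positive measure in the unit interval has an asymptotically non-negligible
intersection with the `c / n`-neighbourhood of the fractions `a / n`, `0 ≤ a < n`. -/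
lemma eventually_le_volume_inter_iUnion_closedBall {c : ℝ} (hc : 0 < c) {E : Set ℝ}
    (hE : MeasurableSet E) (hE1 : E ⊆ Icc 0 1) (hE0 : volume E ≠ 0) :
    ∃ δ : ℝ, 0 < δ ∧ ∀ᶠ n : ℕ in atTop, δ ≤
      volume.real (E ∩ ⋃ a ∈ Finset.range n, Metric.closedBall ((a : ℝ) / n) (c / n)) := by
  have hfin : volume E ≠ ⊤ := measure_ne_top_of_subset hE1 (by simp)
  have hpos : 0 < volume.real E := ENNReal.toReal_pos hE0 hfin
  set K := ⌊1 / (2 * c) + 1 / 2⌋₊ + 1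
  have hK0 : (0 : ℝ) < K := by positivity
  set δ := volume.real E / (2 * K) with hδ
  have hδ0 : 0 < δ := by positivity
  have hsmall : ∀ᶠ n : ℕ in atTop, ∀ j ∈ Finset.range K,
      volume (E \ ((fun x ↦ x - 2 * c * j / n) ⁻¹' E)) < ENNReal.ofReal δ := by
    rw [Filter.eventually_all_finset]
    intro j _
    exact ((tendsto_volume_diff_preimage_sub hE hfin).comp
      (tendsto_const_div_atTop_nhds_zero_nat (2 * c * j))).eventually_lt_const (by simpa)
  refine ⟨δ, hδ0, ?_⟩
  filter_upwards [hsmall, eventually_gt_atTop 0] with n hn hn0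
  set S := ⋃ a ∈ Finset.range n, Metric.closedBall ((a : ℝ) / n) (c / n)
  have hSm : MeasurableSet S := Finset.measurableSet_biUnion _ fun _ _ ↦ measurableSet_closedBall
  have hcover : E ⊆ ⋃ j ∈ Finset.range K, ((fun x ↦ x - 2 * c * j / n) ⁻¹' (E ∩ S)) ∪
      (E \ ((fun x ↦ x - 2 * c * j / n) ⁻¹' E)) := by
    intro x hx
    obtain ⟨j, hj, hxj⟩ := exists_sub_mem_iUnion_closedBall hc hn0 (hE1 hx)
    simp only [mem_iUnion]
    refine ⟨j, hj, ?_⟩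
    by_cases h : x - 2 * c * j / n ∈ E
    · exact Or.inl ⟨h, hxj⟩
    · exact Or.inr ⟨hx, h⟩
  have hle : volume E ≤ K * (volume (E ∩ S) + ENNReal.ofReal δ) := by
    calc volume E ≤ ∑ j ∈ Finset.range K, (volume (E ∩ S) + ENNReal.ofReal δ) := by
          refine (measure_mono hcover).trans ((measure_biUnion_finset_le _ _).trans ?_)
          refine Finset.sum_le_sum fun j hj ↦ (measure_union_le _ _).trans ?_
          exact add_le_add ((measurePreserving_sub_right volume _).measure_preimage
            (hE.inter hSm).nullMeasurableSet).le (hn j hj).le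
      _ = _ := by simp [mul_add]
  have hfinS : volume (E ∩ S) ≠ ⊤ := measure_ne_top_of_subset inter_subset_left hfin
  have hle' : volume.real E ≤ K * (volume.real (E ∩ S) + δ) := by
    have := ENNReal.toReal_mono (by finiteness) hle
    rwa [ENNReal.toReal_mul, ENNReal.toReal_add hfinS (by simp), ENNReal.toReal_ofReal hδ0.le,
      ENNReal.toReal_natCast] at this
  have hEδ : volume.real E = K * (2 * δ) := by rw [hδ]; field_simp
  rw [hEδ] at hle'
  linarith [le_of_mul_le_mul_left hle' hK0]

/-- Some numerator `a < n` gives a ball around `a / n` capturing at least the average share. -/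
lemma exists_volume_inter_iUnion_le_mul (c : ℝ) (V : Set ℝ) {n : ℕ} (hn : 0 < n) :
    ∃ a < n, volume.real (V ∩ ⋃ a ∈ Finset.range n, Metric.closedBall ((a : ℝ) / n) (c / n)) ≤
      n * volume.real (V ∩ Metric.closedBall ((a : ℝ) / n) (c / n)) := by
  by_contra! h
  have hne : (Finset.range n).Nonempty := ⟨0, Finset.mem_range.2 hn⟩
  have hlt := Finset.sum_lt_sum_of_nonempty hne fun a ha ↦ h a (Finset.mem_range.1 ha)
  rw [← Finset.mul_sum, Finset.sum_const, Finset.card_range, nsmul_eq_mul] at hlt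
  have hle := measureReal_biUnion_finset_le (μ := volume) (Finset.range n)
    fun a : ℕ ↦ V ∩ Metric.closedBall ((a : ℝ) / n) (c / n)
  rw [← inter_iUnion₂] at hle
  exact absurd (lt_of_mul_lt_mul_left hlt n.cast_nonneg) hle.not_gt

/-- If the reciprocals of the elements of `P` have divergent sum, then numerators `a n` can be
chosen greedily so that the balls `closedBall (a n / n) (c / n)`, `n ∈ P`, leave arbitrarily
little of the unit interval uncovered. -/
theorem exists_numerators_tendsto_volume_uncovered {c : ℝ} (hc : 0 < c) (P : Set ℕ)
    (hP : ¬ Summable (P.indicator fun n : ℕ ↦ (1 : ℝ) / n)) :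
    ∃ a : ℕ → ℕ, (∀ n, 0 < n → a n < n) ∧
      Tendsto (fun N : ℕ ↦ volume (Icc (0 : ℝ) 1 \
        {x | ∃ n ∈ P, n < N ∧ x ∈ Metric.closedBall ((a n : ℝ) / n) (c / n)})) atTop (𝓝 0) := by
  classical
  have hchoice (V : Set ℝ) (n : ℕ) : ∃ a, 0 < n → a < n ∧
      volume.real (V ∩ ⋃ a ∈ Finset.range n, Metric.closedBall ((a : ℝ) / n) (c / n)) ≤
        n * volume.real (V ∩ Metric.closedBall ((a : ℝ) / n) (c / n)) := by
    rcases n.eq_zero_or_pos with h | h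
    · exact ⟨0, fun h' ↦ absurd h h'.ne'⟩
    · obtain ⟨a, ha⟩ := exists_volume_inter_iUnion_le_mul c V h
      exact ⟨a, fun _ ↦ ha⟩
  choose g hg using hchoice
  let U : ℕ → Set ℝ := fun N ↦ Nat.rec (Icc (0 : ℝ) 1)
    (fun n V ↦ if n ∈ P then V \ Metric.closedBall ((g V n : ℝ) / n) (c / n) else V) N
  have hUsucc (n : ℕ) : U (n + 1) =
      if n ∈ P then U n \ Metric.closedBall ((g (U n) n : ℝ) / n) (c / n) else U n := rfl
  have hUeq (N : ℕ) : U N = Icc (0 : ℝ) 1 \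
      {x | ∃ n ∈ P, n < N ∧ x ∈ Metric.closedBall ((g (U n) n : ℝ) / n) (c / n)} := by
    induction N with
    | zero => simp [U]
    | succ N ih =>
      rw [hUsucc]
      split_ifs with h
      all_goals
        nth_rewrite 1 [ih]
        ext x
        simp only [Set.mem_sdiff, mem_ofPred_eq, Nat.lt_succ_iff_lt_or_eq]
        grind
  refine ⟨fun n ↦ g (U n) n, fun n hn ↦ (hg _ n hn).1, ?_⟩
  simp_rw [← hUeq]
  have hanti : Antitone U := antitone_nat_of_succ_le fun n ↦ by
    rw [hUsucc]
    split_ifs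
    exacts [sdiff_subset, le_rfl]
  have hmeas (n : ℕ) : MeasurableSet (U n) := by
    induction n with
    | zero => exact measurableSet_Icc
    | succ n ih =>
      rw [hUsucc]
      split_ifs
      exacts [ih.diff measurableSet_closedBall, ih]
  have hsub (n : ℕ) : U n ⊆ Icc 0 1 := hanti n.zero_le
  have hfin (n : ℕ) : volume (U n) ≠ ⊤ := measure_ne_top_of_subset (hsub n) (by simp)
  have hlim := tendsto_measure_iInter_atTop (fun n ↦ (hmeas n).nullMeasurableSet) hanti
    ⟨0, hfin 0⟩
  suffices h0 : volume (⋂ n, U n) = 0 by rwa [h0] at hlim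
  by_contra h0
  obtain ⟨δ, hδ, hev⟩ := eventually_le_volume_inter_iUnion_closedBall hc
    (MeasurableSet.iInter hmeas) ((iInter_subset U 0).trans (hsub 0)) h0
  have hgain : Summable fun n ↦ volume.real (U n) - volume.real (U (n + 1)) := by
    refine summable_of_sum_range_le (c := volume.real (U 0))
      (fun n ↦ sub_nonneg.2 (measureReal_mono (hanti n.le_succ) (hfin n))) fun n ↦ ?_
    rw [Finset.sum_range_sub']
    linarith [measureReal_nonneg (μ := volume) (s := U n)]
  refine hP ((hgain.mul_left δ⁻¹).of_norm_bounded_eventually_nat ?_)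
  filter_upwards [hev, eventually_gt_atTop 0] with n hn hn0
  have hn' : (0 : ℝ) < n := by exact_mod_cast hn0
  by_cases h : n ∈ P
  · have hstep : volume.real (U n) - volume.real (U (n + 1)) =
        volume.real (U n ∩ Metric.closedBall ((g (U n) n : ℝ) / n) (c / n)) := by
      rw [hUsucc, if_pos h, ← measureReal_inter_add_sdiff (s := U n)
        (measurableSet_closedBall (x := (g (U n) n : ℝ) / n) (ε := c / n)) (hfin n)]
      ring
    have hshare := (hn.trans (measureReal_mono (inter_subset_inter_left _ (iInter_subset U n))
      (measure_ne_top_of_subset inter_subset_left (hfin n)))).trans (hg (U n) n hn0).2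
    rw [indicator_of_mem h, hstep, Real.norm_of_nonneg (by positivity), ← div_eq_inv_mul,
      div_le_div_iff₀ hn' hδ]
    linarith
  · rw [indicator_of_notMem h, norm_zero]
    exact mul_nonneg (inv_nonneg.2 hδ.le)
      (sub_nonneg.2 (measureReal_mono (hanti n.le_succ) (hfin n)))

/-- The sum of the reciprocals of the primes exceeding `X` diverges. -/
lemma not_summable_one_div_primes_gt (X : ℝ) :
    ¬ Summable ({p : ℕ | p.Prime ∧ X < p}.indicator fun n : ℕ ↦ (1 : ℝ) / n) := by
  intro h
  refine not_summable_one_div_on_primes (h.of_norm_bounded_eventually_nat ?_)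
  filter_upwards [tendsto_natCast_atTop_atTop.eventually_gt_atTop X] with n hn
  by_cases hp : n.Prime
  · rw [indicator_of_mem (show n ∈ {p : ℕ | p.Prime} from hp),
      indicator_of_mem (show n ∈ {p : ℕ | p.Prime ∧ X < p} from ⟨hp, hn⟩),
      Real.norm_of_nonneg (by positivity)]
  · rw [indicator_of_notMem (show n ∉ {p : ℕ | p.Prime} from hp), norm_zero]
    exact indicator_nonneg (fun _ _ ↦ by positivity) _

/-- For `0 < c ≤ 1/2`, every real `X ≥ 2` and every `ε > 0`, there exist a real `Y > X`
and integers `a_p` with `0 ≤ a_p < p` for the primes `X < p ≤ Y`, such that the set of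
`x ∈ [0,1]` with `|x - a_p/p| ≤ c/p` for some prime `X < p ≤ Y` has Lebesgue measure at
least `1 - ε`. -/
theorem good_numerators_in_range (c : ℝ) (hc0 : 0 < c) (hc : c ≤ 1 / 2)
    (X : ℝ) (hX : 2 ≤ X) (ε : ℝ) (hε : 0 < ε) :
    ∃ Y : ℝ, X < Y ∧
      ∃ a : ℕ → ℕ, (∀ p : ℕ, p.Prime → X < (p : ℝ) → (p : ℝ) ≤ Y → a p < p) ∧
        ENNReal.ofReal (1 - ε) ≤
          (volume.restrict (Set.Icc (0 : ℝ) 1))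
            {x : ℝ | ∃ p : ℕ, p.Prime ∧ X < (p : ℝ) ∧ (p : ℝ) ≤ Y ∧
              |x - (a p : ℝ) / (p : ℝ)| ≤ c / (p : ℝ)} := by
  obtain ⟨a, ha, hlim⟩ := exists_numerators_tendsto_volume_uncovered hc0 _
    (not_summable_one_div_primes_gt X)
  obtain ⟨N, hN, hXN⟩ := ((hlim.eventually_lt_const (ENNReal.ofReal_pos.2 hε)).and
    (tendsto_natCast_atTop_atTop.eventually_gt_atTop X)).exists
  refine ⟨N, hXN, a, fun p hp _ _ ↦ ha p hp.pos, ?_⟩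
  set A := {x : ℝ | ∃ p : ℕ, p.Prime ∧ X < (p : ℝ) ∧ (p : ℝ) ≤ N ∧
    |x - (a p : ℝ) / (p : ℝ)| ≤ c / (p : ℝ)}
  rw [Measure.restrict_apply' measurableSet_Icc, ENNReal.ofReal_sub _ hε.le, ENNReal.ofReal_one,
    tsub_le_iff_right]
  calc (1 : ENNReal) = volume (Icc (0 : ℝ) 1) := by simp
    _ ≤ volume (A ∩ Icc 0 1) + volume (Icc (0 : ℝ) 1 \ A) := by
      rw [inter_comm]
      exact measure_le_inter_add_sdiff _ _ _
    _ ≤ volume (A ∩ Icc 0 1) + ENNReal.ofReal ε := by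
      gcongr
      refine (measure_mono (sdiff_subset_sdiff_right ?_)).trans hN.le
      rintro x ⟨p, ⟨hp, hXp⟩, hpN, hx⟩
      exact ⟨p, hp, hXp, by exact_mod_cast hpN.le, hx⟩
end

section
/- Let 0 < c ≤ 1/2. With notation as in the context, for almost every sequence a ∈ 𝒜 (with respect to the product probability measure), the set A_a = { x ∈ [0,1] : |x − a_p/p| ≤ c/p for infinitely many primes p } has Lebesgue measure 1. -/
open MeasureTheory
open scoped ENNReal

open ProbabilityTheory in
lemma variance_sum_indicator_le {Ω ι : Type*} [MeasurableSpace Ω] {P : Measure Ω}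
    [IsProbabilityMeasure P] {E : ι → Set Ω} (hE : ∀ i, MeasurableSet (E i)) {w : ι → ℝ}
    (hw : ∀ i, 0 ≤ w i) {m : ℝ} (hPE : ∀ i, P.real (E i) = m)
    (hcov : ∀ i j, i ≠ j → P.real (E i ∩ E j) ≤ m ^ 2 + w i) (s : Finset ι) :
    Var[∑ i ∈ s, (E i).indicator (fun _ => w i); P] ≤
      (1 + ∑ i ∈ s, w i) * ∑ i ∈ s, w i ^ 2 := by
  classical
  have hX : ∀ i, MemLp ((E i).indicator (fun _ => w i)) 2 P := fun i =>
    (memLp_const (w i)).indicator (hE i)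
  have hint : ∀ i, ∫ x, (E i).indicator (fun _ => w i) x ∂P = m * w i := fun i => by
    rw [integral_indicator_const _ (hE i), hPE, smul_eq_mul]
  have hterm : ∀ i j, cov[(E i).indicator (fun _ => w i), (E j).indicator (fun _ => w j); P] ≤
      w i ^ 2 * w j + if i = j then w i ^ 2 else 0 := by
    intro i j
    have hmul : (E i).indicator (fun _ => w i) * (E j).indicator (fun _ => w j) =
        (E i ∩ E j).indicator (fun _ => w i * w j) :=
      funext fun x => (Set.inter_indicator_mul (fun _ => w i) (fun _ => w j) x).symm
    rw [covariance_eq_sub (hX i) (hX j), hint, hint, hmul,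
      integral_indicator_const _ ((hE i).inter (hE j)), smul_eq_mul]
    have hij : 0 ≤ w i * w j := mul_nonneg (hw i) (hw j)
    split_ifs with h
    · subst h
      have h1 : P.real (E i ∩ E i) ≤ 1 := measureReal_le_one
      have h2 : 0 ≤ w i ^ 2 * w i := mul_nonneg (sq_nonneg _) (hw i)
      nlinarith [sq_nonneg (m * w i)]
    · nlinarith [hcov i j h]
  rw [variance_sum' fun i _ => hX i]
  calc _ ≤ ∑ i ∈ s, ∑ j ∈ s, (w i ^ 2 * w j + if i = j then w i ^ 2 else 0) :=
        Finset.sum_le_sum fun i _ => Finset.sum_le_sum fun j _ => hterm i j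
    _ = ∑ i ∈ s, (w i ^ 2 * (∑ j ∈ s, w j) + w i ^ 2) := by
        refine Finset.sum_congr rfl fun i hi => ?_
        rw [Finset.sum_add_distrib, Finset.mul_sum, Finset.sum_ite_eq, if_pos hi]
    _ = _ := by
        rw [Finset.sum_add_distrib, ← Finset.sum_mul]
        ring

open ProbabilityTheory in
/-- A divergent series of weights stays divergent almost surely when it is restricted to the
events that occur, if the events are equiprobable and weakly correlated. -/
lemma ae_not_summable_indicator {Ω ι : Type*} [MeasurableSpace Ω] {P : Measure Ω}
    [IsProbabilityMeasure P] {E : ι → Set Ω} (hE : ∀ i, MeasurableSet (E i)) {w : ι → ℝ}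
    (hw : ∀ i, 0 ≤ w i) (hsum : ¬ Summable w) (hsq : Summable fun i => w i ^ 2)
    {m : ℝ} (hm : 0 < m) (hPE : ∀ i, P.real (E i) = m)
    (hcov : ∀ i j, i ≠ j → P.real (E i ∩ E j) ≤ m ^ 2 + w i) :
    ∀ᵐ x ∂P, ¬ Summable ({i | x ∈ E i}.indicator w) := by
  have hbad : ∀ K : ℕ, P {x | ∀ s : Finset ι, ∑ i ∈ s, (E i).indicator (fun _ => w i) x ≤ K}
      = 0 := by
    intro K
    refine le_antisymm (ENNReal.le_of_forall_pos_le_add fun ε hε _ => ?_) zero_le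
    set Q := ∑' i, w i ^ 2 with hQ
    have hQ0 : 0 ≤ Q := tsum_nonneg fun i => sq_nonneg _
    obtain ⟨s, hs⟩ : ∃ s : Finset ι,
        max 1 (max (2 * K / m) (8 * Q / (m ^ 2 * ε))) < ∑ i ∈ s, w i := by
      by_contra! h
      exact hsum (summable_of_sum_le hw h)
    set M := ∑ i ∈ s, w i with hM
    obtain ⟨h1, h2, h3⟩ : 1 < M ∧ 2 * K / m < M ∧ 8 * Q / (m ^ 2 * ε) < M := by
      simpa using hs
    have hε' : (0 : ℝ) < ε := hε
    rw [div_lt_iff₀ (by positivity)] at h2 h3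
    have hX : ∀ i, MemLp ((E i).indicator (fun _ => w i)) 2 P := fun i =>
      (memLp_const (w i)).indicator (hE i)
    have hmean : ∫ x, (∑ i ∈ s, (E i).indicator (fun _ => w i)) x ∂P = m * M := by
      simp_rw [Finset.sum_apply]
      rw [integral_finsetSum _ fun i _ => (hX i).integrable (by norm_num), hM, Finset.mul_sum]
      refine Finset.sum_congr rfl fun i _ => ?_
      rw [integral_indicator_const _ (hE i), hPE, smul_eq_mul]
    have hvar : Var[∑ i ∈ s, (E i).indicator (fun _ => w i); P] ≤ 2 * M * Q := by
      refine (variance_sum_indicator_le hE hw hPE hcov s).trans ?_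
      have : ∑ i ∈ s, w i ^ 2 ≤ Q := hsq.sum_le_tsum s fun i _ => sq_nonneg _
      gcongr
      linarith
    have hcheb := meas_ge_le_variance_div_sq (μ := P)
      (memLp_finsetSum' s fun i _ => hX i) (c := m * M / 2) (by positivity)
    rw [hmean] at hcheb
    rw [zero_add]
    refine (measure_mono fun x hx => ?_).trans (hcheb.trans ?_)
    · have := hx s
      rw [Set.mem_ofPred_eq, Finset.sum_apply, abs_sub_comm]
      exact le_trans (by linarith) (le_abs_self _)
    · rw [← ENNReal.ofReal_coe_nnreal]
      refine ENNReal.ofReal_le_ofReal ?_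
      rw [div_le_iff₀ (by positivity)]
      nlinarith
  filter_upwards [ae_all_iff.2 fun K => measure_eq_zero_iff_ae_notMem.1 (hbad K)] with x hx hS
  obtain ⟨K, hK⟩ := exists_nat_ge (∑' i, {i | x ∈ E i}.indicator w i)
  refine hx K fun s => le_trans ?_ hK
  refine le_trans (le_of_eq ?_)
    (hS.sum_le_tsum s fun i _ => Set.indicator_nonneg (fun i _ => hw i) i)
  exact Finset.sum_congr rfl fun i _ => by
    classical
    rw [Set.indicator_apply, Set.indicator_apply]
    exact if_congr Iff.rfl rfl rfl

lemma card_filter_norm_add_mul_div_le {c : ℝ} (hc : 0 ≤ c) {p q : ℕ} (hp : 0 < p)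
    (hpq : p.Coprime q) (y : ℝ) :
    (((Finset.range p).filter fun j : ℕ =>
      ‖((y + q * (j / p) : ℝ) : UnitAddCircle)‖ ≤ c).card : ℝ) ≤ 2 * c * p + 1 := by
  have hp' : (0 : ℝ) < p := by exact_mod_cast hp
  set f : ℕ → ℤ := fun j => j * q - p * round (y + q * (j / p) : ℝ) with hf
  have hmap : ∀ j ∈ (Finset.range p).filter fun j : ℕ =>
      ‖((y + q * (j / p) : ℝ) : UnitAddCircle)‖ ≤ c,
      f j ∈ Finset.Icc ⌈p * (-c - y)⌉ ⌊p * (c - y)⌋ := by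
    intro j hj
    rw [Finset.mem_filter, UnitAddCircle.norm_eq, abs_le] at hj
    obtain ⟨-, h1, h2⟩ := hj
    have hfj : (f j : ℝ) = p * ((y + q * (j / p) : ℝ) - round (y + q * (j / p) : ℝ) - y) := by
      simp only [hf]
      push_cast
      field_simp
      ring
    rw [Finset.mem_Icc, Int.ceil_le, Int.le_floor, hfj]
    constructor <;> gcongr
  have hinj : Set.InjOn f ((Finset.range p).filter fun j : ℕ =>
      ‖((y + q * (j / p) : ℝ) : UnitAddCircle)‖ ≤ c : Finset ℕ) := by
    intro i hi j hj hij
    simp only [Finset.coe_filter, Finset.mem_range, Set.mem_ofPred_eq] at hi hj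
    have hmod : (i * q : ℤ) ≡ j * q [ZMOD p] := by
      refine (Int.modEq_iff_dvd.2 ⟨round (y + q * (j / p) : ℝ) - round (y + q * (i / p) : ℝ), ?_⟩)
      simp only [hf] at hij
      linear_combination -hij
    have hmod' : i * q ≡ j * q [MOD p] := by
      rw [← Int.natCast_modEq_iff]; push_cast; exact hmod
    have := Nat.ModEq.cancel_right_of_coprime hpq hmod'
    exact Nat.ModEq.eq_of_lt_of_lt this hi.1 hj.1
  have hcard := Finset.card_le_card_of_injOn f hmap hinj
  rw [Int.card_Icc] at hcard
  have h1 := Int.floor_le (p * (c - y))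
  have h2 := Int.le_ceil (p * (-c - y))
  refine (Nat.cast_le.2 hcard).trans ?_
  have h3 : ((⌊p * (c - y)⌋ + 1 - ⌈p * (-c - y)⌉ : ℤ) : ℝ) ≤ 2 * c * p + 1 := by
    push_cast
    linarith
  rcases le_total 0 (⌊p * (c - y)⌋ + 1 - ⌈p * (-c - y)⌉) with h | h
  · rw [← Int.cast_natCast, Int.toNat_of_nonneg h]
    exact h3
  · rw [Int.toNat_of_nonpos h]
    simpa using by positivity

lemma measurableSet_norm_nsmul_le (c : ℝ) (n : ℕ) :
    MeasurableSet {x : UnitAddCircle | ‖n • x‖ ≤ c} :=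
  (isClosed_le (by fun_prop) continuous_const).measurableSet

lemma measureReal_norm_nsmul_le {c : ℝ} (hc0 : 0 ≤ c) (hc : c ≤ 1 / 2) {n : ℕ} (hn : n ≠ 0) :
    (volume : Measure UnitAddCircle).real {x | ‖n • x‖ ≤ c} = 2 * c := by
  have h := (Measure.measurePreserving_zsmul (volume : Measure UnitAddCircle)
    (n := n) (by exact_mod_cast hn)).measure_preimage
    (Metric.isClosed_closedBall (x := (0 : UnitAddCircle)) (ε := c)).measurableSet.nullMeasurableSet
  have hset : {x : UnitAddCircle | ‖n • x‖ ≤ c} =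
      (fun x : UnitAddCircle => (n : ℤ) • x) ⁻¹' Metric.closedBall 0 c := by
    ext x
    simp
  rw [measureReal_def, hset, h, AddCircle.volume_closedBall, min_eq_right (by linarith),
    ENNReal.toReal_ofReal (by linarith)]

lemma measureReal_norm_nsmul_le_inter {c : ℝ} (hc0 : 0 ≤ c) (hc : c ≤ 1 / 2) {p q : ℕ}
    (hp : 0 < p) (hpq : p.Coprime q) :
    (volume : Measure UnitAddCircle).real ({x | ‖p • x‖ ≤ c} ∩ {x | ‖q • x‖ ≤ c}) ≤
      (2 * c) ^ 2 + 1 / p := by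
  have hp' : (0 : ℝ) < p := by exact_mod_cast hp
  set A : Set UnitAddCircle := {x | ‖p • x‖ ≤ c} with hA
  set B : Set UnitAddCircle := {x | ‖q • x‖ ≤ c} with hB
  have hAm : MeasurableSet A := measurableSet_norm_nsmul_le c p
  have hBm : MeasurableSet B := measurableSet_norm_nsmul_le c q
  have hABm := hAm.inter hBm
  set t : ℕ → UnitAddCircle := fun j => ((j / p : ℝ) : UnitAddCircle) with ht
  have hshift : ∀ j x, (x + t j ∈ A ↔ x ∈ A) := by
    intro j x
    have : p • t j = 0 := by
      simp only [ht]
      rw [← AddCircle.coe_nsmul, nsmul_eq_mul, mul_div_cancel₀ _ hp'.ne']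
      rw [AddCircle.coe_eq_zero_iff]
      exact ⟨j, by simp⟩
    simp only [hA, Set.mem_ofPred_eq, smul_add, this, add_zero]
  have hcount : ∀ x, ∑ j ∈ Finset.range p, (A ∩ B).indicator (fun _ => (1 : ℝ)) (x + t j) ≤
      A.indicator (fun _ => 2 * c * p + 1) x := by
    intro x
    by_cases hx : x ∈ A
    · rw [Set.indicator_of_mem hx]
      obtain ⟨r, rfl⟩ := QuotientAddGroup.mk_surjective x
      refine le_trans (le_of_eq ?_) (card_filter_norm_add_mul_div_le hc0 hp hpq (q * r))
      rw [Finset.card_filter]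
      push_cast
      refine Finset.sum_congr rfl fun j _ => ?_
      have hBj : ((r : UnitAddCircle) + t j ∈ B) ↔
          ‖((q * r + q * (j / p) : ℝ) : UnitAddCircle)‖ ≤ c := by
        simp only [hB, ht, Set.mem_ofPred_eq]
        rw [← AddCircle.coe_add, ← AddCircle.coe_nsmul, nsmul_eq_mul, mul_add]
      rw [Set.indicator_apply]
      refine if_congr ?_ rfl rfl
      rw [← hBj, Set.mem_inter_iff, and_iff_right ((hshift j _).2 hx)]
    · rw [Set.indicator_of_notMem hx]
      refine (Finset.sum_eq_zero fun j _ => Set.indicator_of_notMem ?_ _).le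
      exact fun h => hx ((hshift j x).1 h.1)
  have hI : Integrable ((A ∩ B).indicator fun _ => (1 : ℝ)) (volume : Measure UnitAddCircle) :=
    (integrable_const _).indicator hABm
  have hle : ∫ x, ∑ j ∈ Finset.range p, (A ∩ B).indicator (fun _ => (1 : ℝ)) (x + t j) ≤
      ∫ x, A.indicator (fun _ => 2 * c * p + 1) x :=
    integral_mono (integrable_finsetSum _ fun j _ => hI.comp_add_right (t j))
      ((integrable_const _).indicator hAm) hcount
  rw [integral_finsetSum _ fun j _ => hI.comp_add_right (t j),
    integral_indicator_const _ hAm, measureReal_norm_nsmul_le hc0 hc hp.ne'] at hle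
  simp_rw [integral_add_right_eq_self ((A ∩ B).indicator fun _ => (1 : ℝ)),
    integral_indicator_const _ hABm] at hle
  rw [Finset.sum_const, Finset.card_range, nsmul_eq_mul, smul_eq_mul, smul_eq_mul, mul_one] at hle
  rw [← mul_le_mul_iff_right₀ hp', mul_add, mul_one_div_cancel hp'.ne']
  nlinarith

lemma ae_not_summable_one_div_primes_norm_nsmul_le {c : ℝ} (hc0 : 0 < c) (hc : c ≤ 1 / 2) :
    ∀ᵐ x : UnitAddCircle, ¬ Summable
      ({p : Nat.Primes | ‖(p : ℕ) • x‖ ≤ c}.indicator fun p => 1 / ((p : ℕ) : ℝ)) := by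
  have : IsProbabilityMeasure (volume : Measure UnitAddCircle) := ⟨by simp⟩
  refine ae_not_summable_indicator (m := 2 * c)
    (E := fun p : Nat.Primes => {x : UnitAddCircle | ‖(p : ℕ) • x‖ ≤ c})
    (fun p => measurableSet_norm_nsmul_le c p) (fun p => by positivity)
    Nat.Primes.not_summable_one_div ?_ (by positivity)
    (fun p => measureReal_norm_nsmul_le hc0.le hc p.2.ne_zero)
    (fun p q hpq => measureReal_norm_nsmul_le_inter hc0.le hc p.2.pos
      ((Nat.coprime_primes p.2 q.2).2 (Nat.Primes.coe_nat_injective.ne hpq)))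
  refine ((Nat.Primes.summable_rpow (r := -2)).2 (by norm_num)).congr fun p => ?_
  rw [Real.rpow_neg (by positivity), one_div, inv_pow]
  norm_cast

/-- For almost every `x ∈ [0, 1]`, the primes `p` for which some fraction with denominator `p`
and numerator in `{0, …, p - 1}` lies within `c / p` of `x` have a divergent sum of
reciprocals. -/
lemma ae_not_summable_one_div_primes_approximable {c : ℝ} (hc0 : 0 < c) (hc : c ≤ 1 / 2) :
    ∀ᵐ x ∂volume.restrict (Set.Icc (0 : ℝ) 1), ¬ Summable
      ({p : Nat.Primes | ∃ v : Fin (p : ℕ), |x - ((v : ℕ) : ℝ) / ((p : ℕ) : ℝ)| ≤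
        c / ((p : ℕ) : ℝ)}.indicator fun p => 1 / ((p : ℕ) : ℝ)) := by
  rw [← restrict_Ioo_eq_restrict_Icc]
  have hmp := UnitAddCircle.measurePreserving_mk 0
  rw [zero_add, ← restrict_Ioo_eq_restrict_Ioc] at hmp
  filter_upwards [hmp.quasiMeasurePreserving.ae
    (ae_not_summable_one_div_primes_norm_nsmul_le hc0 hc), ae_restrict_mem measurableSet_Ioo]
    with x hx hx01 hS
  refine hx ((summable_congr_cofinite ?_).2 hS)
  have hfin : {p : Nat.Primes | (p : ℕ) ≤ 1 / (1 - x)}.Finite := by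
    obtain ⟨N, hN⟩ := exists_nat_ge (1 / (1 - x))
    refine Set.Finite.subset ((Set.finite_Iic N).preimage
      Nat.Primes.coe_nat_injective.injOn) fun p hp => ?_
    exact Nat.cast_le.1 (le_trans hp hN)
  filter_upwards [hfin.compl_mem_cofinite] with p hp
  have hp0 : (0 : ℝ) < (p : ℕ) := by exact_mod_cast p.2.pos
  have hp1 : 1 < (p : ℕ) * (1 - x) := by
    have : 1 / (1 - x) < (p : ℕ) := not_le.1 hp
    rwa [div_lt_iff₀ (by linarith [hx01.2])] at this
  have hdiv : ∀ v : ℝ, |x - v / (p : ℕ)| ≤ c / (p : ℕ) ↔ |(p : ℕ) * x - v| ≤ c := by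
    intro v
    rw [le_div_iff₀ hp0, ← abs_of_pos hp0, ← abs_mul, abs_of_pos hp0, sub_mul,
      div_mul_cancel₀ _ hp0.ne', mul_comm x]
  have hnorm : ‖(p : ℕ) • (x : UnitAddCircle)‖ =
      |((p : ℕ) : ℝ) * x - round (((p : ℕ) : ℝ) * x)| := by
    rw [← AddCircle.coe_nsmul, nsmul_eq_mul, UnitAddCircle.norm_eq]
  classical
  rw [Set.indicator_apply, Set.indicator_apply]
  refine if_congr ?_ rfl rfl
  change ‖(p : ℕ) • (x : UnitAddCircle)‖ ≤ c ↔
    ∃ v : Fin (p : ℕ), |x - ((v : ℕ) : ℝ) / ((p : ℕ) : ℝ)| ≤ c / ((p : ℕ) : ℝ)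
  simp_rw [hdiv]
  rw [hnorm]
  constructor
  · intro h
    have hr := abs_le.1 (abs_sub_round (((p : ℕ) : ℝ) * x))
    have hpx : 0 < ((p : ℕ) : ℝ) * x := mul_pos hp0 hx01.1
    have h0 : 0 ≤ round (((p : ℕ) : ℝ) * x) := by
      have : ((-1 : ℤ) : ℝ) < round (((p : ℕ) : ℝ) * x) := by push_cast; linarith
      have := Int.cast_lt.1 this
      omega
    have h1 : round (((p : ℕ) : ℝ) * x) < (p : ℕ) := by
      have : (round (((p : ℕ) : ℝ) * x) : ℝ) < ((p : ℕ) : ℤ) := by push_cast; linarith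
      exact Int.cast_lt.1 this
    obtain ⟨k, hk⟩ := Int.eq_ofNat_of_zero_le h0
    rw [hk] at h h1
    exact ⟨⟨k, by exact_mod_cast h1⟩, by exact_mod_cast h⟩
  · rintro ⟨v, hv⟩
    exact (round_le _ ((v : ℕ) : ℤ)).trans (by exact_mod_cast hv)

open ProbabilityTheory in
lemma IsUniformProductMeasure.ae_infinite_eq {μ : Measure PrimeSeq}
    (hμ : IsUniformProductMeasure μ) {G : Set Nat.Primes} (v : PrimeSeq)
    (hG : ¬ Summable (G.indicator fun p => 1 / ((p : ℕ) : ℝ))) :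
    ∀ᵐ a ∂μ, {p | p ∈ G ∧ a p = v p}.Infinite := by
  have := hμ.1
  have hinf : G.Infinite := by
    intro hfin
    refine hG (summable_of_hasFiniteSupport (hfin.subset ?_))
    exact Set.support_indicator_subset
  have : Infinite G := hinf.to_subtype
  obtain ⟨_⟩ := nonempty_denumerable G
  let e : ℕ ≃ G := (Denumerable.eqv G).symm
  have hinj : Function.Injective fun n => (e n : Nat.Primes) :=
    Subtype.val_injective.comp e.injective
  set s : ℕ → Set PrimeSeq := fun n => {a | a (e n) = v (e n)} with hs
  have hsm : ∀ n, MeasurableSet (s n) := fun n =>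
    measurableSet_eq_fun (measurable_pi_apply _) measurable_const
  have hcyl : ∀ t : Finset ℕ, μ (⋂ n ∈ t, s n) = ∏ n ∈ t, (((e n : Nat.Primes) : ℕ) : ℝ≥0∞)⁻¹ := by
    intro t
    classical
    have h := hμ.2 (t.image fun n => (e n : Nat.Primes)) v
    rw [Finset.prod_image hinj.injOn] at h
    rw [← h]
    congr 1
    ext a
    simp [hs]
  have hone : ∀ n, μ (s n) = (((e n : Nat.Primes) : ℕ) : ℝ≥0∞)⁻¹ := fun n => by
    simpa using hcyl {n}
  have hindep : iIndepSet s μ := by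
    rw [iIndepSet_iff_meas_biInter hsm]
    intro t
    rw [hcyl]
    exact Finset.prod_congr rfl fun n _ => (hone n).symm
  have htop : ∑' n, μ (s n) = ∞ := by
    by_contra h
    refine hG ?_
    rw [← summable_subtype_iff_indicator, ← e.summable_iff]
    have h' := ENNReal.summable_toReal h
    refine h'.congr fun n => ?_
    rw [hone]
    simp
  have hlim := measure_limsup_eq_one hsm hindep htop
  have hlimm : MeasurableSet (Filter.limsup s Filter.atTop) :=
    MeasurableSet.measurableSet_limsup hsm
  filter_upwards [(mem_ae_iff_prob_eq_one hlimm).2 hlim] with a ha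
  rw [Filter.mem_limsup_iff_frequently_mem, Nat.frequently_atTop_iff_infinite] at ha
  refine (ha.image hinj.injOn).mono ?_
  rintro _ ⟨n, hn, rfl⟩
  exact ⟨(e n).2, hn⟩

lemma measurableSet_infinite_setOf {α ι : Type*} [MeasurableSpace α] [Countable ι]
    {S : ι → Set α} (hS : ∀ i, MeasurableSet (S i)) :
    MeasurableSet {x | {i | x ∈ S i}.Infinite} := by
  have : {x | {i | x ∈ S i}.Infinite} = ⋂ t : Finset ι, ⋃ i, ⋃ (_ : i ∉ t), S i := by
    ext x
    simp only [Set.mem_iInter, Set.mem_iUnion, exists_prop]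
    constructor
    · intro h t
      obtain ⟨i, hi, hit⟩ := Set.Infinite.exists_notMem_finset h t
      exact ⟨i, hit, hi⟩
    · intro h hfin
      obtain ⟨i, hit, hi⟩ := h hfin.toFinset
      exact hit (hfin.mem_toFinset.2 hi)
  rw [this]
  exact .iInter fun t => .iUnion fun i => .iUnion fun _ => hS i

/-- For `0 < c ≤ 1/2`, for almost every sequence `a ∈ 𝒜` with respect to the product
probability measure, the set `A_a` of `x ∈ [0,1]` such that `|x - a_p/p| ≤ c/p` for
infinitely many primes `p` has Lebesgue measure `1`. -/
theorem ae_sequence_full_measure (c : ℝ) (hc0 : 0 < c) (hc : c ≤ 1 / 2)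
    (μ : Measure PrimeSeq) (hμ : IsUniformProductMeasure μ) :
    ∀ᵐ a ∂μ,
      (volume.restrict (Set.Icc (0 : ℝ) 1))
        {x : ℝ |
          {p : Nat.Primes | |x - ((a p : ℕ) : ℝ) / ((p : ℕ) : ℝ)| ≤ c / ((p : ℕ) : ℝ)}.Infinite}
        = 1 := by
  have := hμ.1
  have : IsProbabilityMeasure (volume.restrict (Set.Icc (0 : ℝ) 1)) := ⟨by simp⟩
  have hmeas : MeasurableSet {y : PrimeSeq × ℝ | {p : Nat.Primes |
      |y.2 - ((y.1 p : ℕ) : ℝ) / ((p : ℕ) : ℝ)| ≤ c / ((p : ℕ) : ℝ)}.Infinite} := by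
    refine measurableSet_infinite_setOf (S := fun (p : Nat.Primes) => {y : PrimeSeq × ℝ |
      |y.2 - ((y.1 p : ℕ) : ℝ) / ((p : ℕ) : ℝ)| ≤ c / ((p : ℕ) : ℝ)}) fun p => ?_
    have hcoord : Measurable fun y : PrimeSeq × ℝ => ((y.1 p : ℕ) : ℝ) :=
      (measurable_of_countable fun k : Fin (p : ℕ) => ((k : ℕ) : ℝ)).comp
        ((measurable_pi_apply p).comp measurable_fst)
    exact measurableSet_le (measurable_snd.sub (hcoord.div_const _)).abs measurable_const
  have hae : ∀ᵐ a ∂μ, ∀ᵐ x ∂volume.restrict (Set.Icc (0 : ℝ) 1), {p : Nat.Primes |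
      |x - ((a p : ℕ) : ℝ) / ((p : ℕ) : ℝ)| ≤ c / ((p : ℕ) : ℝ)}.Infinite := by
    rw [Measure.ae_ae_comm hmeas]
    filter_upwards [ae_not_summable_one_div_primes_approximable hc0 hc] with x hx
    have hv : ∀ p : Nat.Primes, ∃ v : Fin (p : ℕ),
        (∃ w : Fin (p : ℕ), |x - ((w : ℕ) : ℝ) / ((p : ℕ) : ℝ)| ≤ c / ((p : ℕ) : ℝ)) →
        |x - ((v : ℕ) : ℝ) / ((p : ℕ) : ℝ)| ≤ c / ((p : ℕ) : ℝ) := by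
      intro p
      have : Nonempty (Fin (p : ℕ)) := ⟨⟨0, p.2.pos⟩⟩
      by_cases h : ∃ w : Fin (p : ℕ), |x - ((w : ℕ) : ℝ) / ((p : ℕ) : ℝ)| ≤ c / ((p : ℕ) : ℝ)
      · exact h.imp fun w hw _ => hw
      · exact ⟨Classical.arbitrary _, fun h' => absurd h' h⟩
    choose v hv using hv
    filter_upwards [hμ.ae_infinite_eq v hx] with a ha
    refine ha.mono fun p hp => ?_
    have := hv p hp.1
    rw [← hp.2] at this
    exact this
  filter_upwards [hae] with a ha
  rw [measure_congr (Filter.eventuallyEq_univ.2 ha), measure_univ]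
end

section
/- Let 0 < c ≤ 1/2 and let 1 ≤ X < Y be real numbers. With notation as in the context, define for x ∈ [0,1] the counting function N_{X,Y}(x) = Σ_{X < p ≤ Y} φ_p(x), where φ_p is the indicator function of I_p(a) = [a_p/p − c/p, a_p/p + c/p], and set ν_{X,Y} = 2c H_{X,Y} with H_{X,Y} = Σ_{X < p ≤ Y, p prime} 1/p. Then the expectation over a ∈ 𝒜 of α_{X,Y} = ∫_0^1 (N_{X,Y}(x) − ν_{X,Y})² dx satisfies E(α_{X,Y}) ≪ H_{X,Y}, with implied constant depending only on c. -/
open MeasureTheory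
open scoped ENNReal

/-- `N_{X,Y}(x) = Σ_{X < p ≤ Y} φ_p(x)`, the number of primes `X < p ≤ Y` with
`x ∈ I_p(a) = [a_p/p - c/p, a_p/p + c/p]`. -/
noncomputable def Ncount (c X Y : ℝ) (a : PrimeSeq) (x : ℝ) : ℝ :=
  Nat.card {p : Nat.Primes // X < ((p : ℕ) : ℝ) ∧ ((p : ℕ) : ℝ) ≤ Y ∧
    |x - ((a p : ℕ) : ℝ) / ((p : ℕ) : ℝ)| ≤ c / ((p : ℕ) : ℝ)}

/-- The indicator function of `[i/n - c/n, i/n + c/n]`. -/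
noncomputable def arc (c : ℝ) (n i : ℕ) : ℝ → ℝ :=
  (Set.Icc ((i : ℝ) / n - c / n) ((i : ℝ) / n + c / n)).indicator 1

lemma arc_eq_ite (c : ℝ) (n i : ℕ) (x : ℝ) :
    arc c n i x = if |x - (i : ℝ) / n| ≤ c / n then 1 else 0 := by
  unfold arc
  rw [Set.indicator_apply]
  congr 1
  rw [Set.mem_Icc, abs_le, eq_iff_iff]
  constructor <;> rintro ⟨h1, h2⟩ <;> constructor <;> linarith

lemma arc_nonneg (c : ℝ) (n i : ℕ) (x : ℝ) : 0 ≤ arc c n i x := by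
  rw [arc_eq_ite]; split_ifs <;> norm_num

lemma arc_le_one (c : ℝ) (n i : ℕ) (x : ℝ) : arc c n i x ≤ 1 := by
  rw [arc_eq_ite]; split_ifs <;> norm_num

lemma measurable_arc (c : ℝ) (n i : ℕ) : Measurable (arc c n i) :=
  measurable_one.indicator measurableSet_Icc

lemma integrable_arc (c : ℝ) (n i : ℕ) : Integrable (arc c n i) :=
  (integrable_indicator_iff measurableSet_Icc).2 (integrableOn_const (by simp))

lemma integrable_arc_mul_arc (c : ℝ) (n i m j : ℕ) :
    Integrable (fun x => arc c n i x * arc c m j x) := by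
  refine (integrable_arc c n i).mono'
    ((measurable_arc c n i).mul (measurable_arc c m j)).aestronglyMeasurable (ae_of_all _ fun x => ?_)
  rw [Real.norm_eq_abs, abs_of_nonneg (mul_nonneg (arc_nonneg ..) (arc_nonneg ..))]
  exact mul_le_of_le_one_right (arc_nonneg ..) (arc_le_one ..)

lemma integral_arc {c : ℝ} (hc : 0 ≤ c) (n i : ℕ) : ∫ x, arc c n i x = 2 * c / n := by
  have h : 0 ≤ c / n := by positivity
  unfold arc
  rw [integral_indicator_one measurableSet_Icc, Real.volume_real_Icc_of_le (by linarith)]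
  ring

lemma setIntegral_arc_le {c : ℝ} (hc : 0 ≤ c) (n i : ℕ) (s : Set ℝ) :
    ∫ x in s, arc c n i x ≤ 2 * c / n := by
  rw [← integral_arc hc n i]
  exact setIntegral_le_integral (integrable_arc c n i) (ae_of_all _ (arc_nonneg c n i))

lemma setIntegral_arc_eq {c : ℝ} (hc0 : 0 < c) (hc : c ≤ 1 / 2) {n i : ℕ} (hi0 : i ≠ 0)
    (hi : i < n) : ∫ x in Set.Icc (0 : ℝ) 1, arc c n i x = 2 * c / n := by
  rw [← integral_arc hc0.le n i]
  refine setIntegral_eq_integral_of_forall_compl_eq_zero fun x hx => ?_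
  refine Set.indicator_of_notMem (fun hx' => hx ?_) _
  have hn : (0 : ℝ) < n := by exact_mod_cast (by omega : 0 < n)
  have h1 : (1 : ℝ) ≤ i := by exact_mod_cast Nat.one_le_iff_ne_zero.2 hi0
  have h2 : (i : ℝ) + 1 ≤ n := by exact_mod_cast hi
  rw [← sub_div, ← add_div] at hx'
  refine ⟨le_trans (div_nonneg (by linarith) hn.le) hx'.1, hx'.2.trans ?_⟩
  rw [div_le_one hn]
  linarith

lemma le_sum_setIntegral_arc {c : ℝ} (hc0 : 0 < c) (hc : c ≤ 1 / 2) {n : ℕ} (hn : n ≠ 0) :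
    2 * c - 2 * c / n ≤ ∑ i : Fin n, ∫ x in Set.Icc (0 : ℝ) 1, arc c n i x := by
  obtain ⟨m, rfl⟩ := Nat.exists_eq_succ_of_ne_zero hn
  rw [Fin.sum_univ_succ]
  have h0 : 0 ≤ ∫ x in Set.Icc (0 : ℝ) 1, arc c m.succ ((0 : Fin (m + 1)) : ℕ) x :=
    integral_nonneg (arc_nonneg _ _ _)
  have h1 : ∀ i : Fin m, ∫ x in Set.Icc (0 : ℝ) 1, arc c m.succ (i.succ : ℕ) x
      = 2 * c / (m.succ : ℕ) := fun i => setIntegral_arc_eq hc0 hc (by simp) i.succ.2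
  rw [Finset.sum_congr rfl fun i _ => h1 i]
  simp only [Finset.sum_const, Finset.card_univ, Fintype.card_fin, nsmul_eq_mul]
  have : 2 * c - 2 * c / (m.succ : ℕ) = m * (2 * c / (m.succ : ℕ)) := by
    push_cast; field_simp; ring
  linarith

/-- A set of integers contained in an interval of length `2r` has at most `2r + 1` elements. -/
lemma card_le_of_abs_add_le {s : Finset ℤ} {y r : ℝ} (hr : 0 ≤ r)
    (h : ∀ k ∈ s, |y + (k : ℝ)| ≤ r) : (s.card : ℝ) ≤ 2 * r + 1 := by
  have hsub : s ⊆ Finset.Icc ⌈-y - r⌉ ⌊-y + r⌋ := fun k hk => by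
    have := abs_le.1 (h k hk)
    rw [Finset.mem_Icc]
    exact ⟨Int.ceil_le.2 (by linarith), Int.le_floor.2 (by linarith)⟩
  have hcard := Finset.card_le_card hsub
  rw [Int.card_Icc] at hcard
  have h1 := Int.floor_le (-y + r)
  have h2 := Int.le_ceil (-y - r)
  have h3 : (s.card : ℤ) ≤ max (⌊-y + r⌋ + 1 - ⌈-y - r⌉) 0 := by omega
  have h4 : (s.card : ℝ) ≤ max ((⌊-y + r⌋ : ℝ) + 1 - ⌈-y - r⌉) 0 := by exact_mod_cast h3
  refine h4.trans (max_le ?_ ?_) <;> linarith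

lemma injective_mul_sub_mul {p q : ℕ} (hpq : p.Coprime q) :
    Function.Injective fun ij : Fin p × Fin q => ((ij.1 : ℕ) : ℤ) * q - ((ij.2 : ℕ) : ℤ) * p := by
  rintro ⟨i, j⟩ ⟨i', j'⟩ h
  simp only at h
  have hpq' : IsCoprime (p : ℤ) (q : ℤ) := Nat.isCoprime_iff_coprime.2 hpq
  have hp : (p : ℤ) ∣ ((i : ℕ) : ℤ) - (i' : ℕ) :=
    hpq'.dvd_of_dvd_mul_right ⟨(j : ℕ) - (j' : ℕ), by linarith⟩
  have hi : ((i : ℕ) : ℤ) - (i' : ℕ) = 0 :=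
    Int.eq_zero_of_abs_lt_dvd hp (by rw [abs_lt]; have := i.2; have := i'.2; omega)
  have hq : (q : ℤ) ∣ ((j : ℕ) : ℤ) - (j' : ℕ) :=
    hpq'.symm.dvd_of_dvd_mul_right ⟨(i : ℕ) - (i' : ℕ), by linarith⟩
  have hj : ((j : ℕ) : ℤ) - (j' : ℕ) = 0 :=
    Int.eq_zero_of_abs_lt_dvd hq (by rw [abs_lt]; have := j.2; have := j'.2; omega)
  ext <;> simp only <;> omega

lemma sum_arc_translate_le {c : ℝ} (hc : 0 ≤ c) {p q : ℕ} (hp : p ≠ 0) (hq : q ≠ 0)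
    (hpq : p.Coprime q) (t : ℝ) :
    ∑ ij : Fin p × Fin q, arc c q ij.2 (t + ((ij.1 : ℕ) : ℝ) / p) ≤ 2 * (c * p) + 1 := by
  simp only [arc_eq_ite]
  rw [Finset.sum_boole, ← Finset.card_image_of_injective _ (injective_mul_sub_mul hpq)]
  refine card_le_of_abs_add_le (y := p * q * t) (by positivity) fun k hk => ?_
  obtain ⟨⟨i, j⟩, hij, rfl⟩ := Finset.mem_image.1 hk
  have hij := (Finset.mem_filter.1 hij).2
  simp only at hij
  have hp' : (0 : ℝ) < p := by positivity
  have hq' : (0 : ℝ) < q := by positivity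
  have : (p : ℝ) * q * t + (((((i : ℕ) : ℤ) * q - ((j : ℕ) : ℤ) * p : ℤ)) : ℝ)
      = p * q * (t + ((i : ℕ) : ℝ) / p - ((j : ℕ) : ℝ) / q) := by
    push_cast; field_simp; ring
  rw [this, abs_mul, abs_of_pos (by positivity : (0 : ℝ) < p * q)]
  calc (p : ℝ) * q * |t + ((i : ℕ) : ℝ) / p - ((j : ℕ) : ℝ) / q|
      ≤ p * q * (c / q) := by gcongr
    _ = c * p := by field_simp

lemma arc_translate (c : ℝ) (n i : ℕ) (t : ℝ) : arc c n i (t + (i : ℝ) / n) = arc c n 0 t := by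
  simp [arc_eq_ite]

lemma sum_setIntegral_arc_mul_arc_le {c : ℝ} (hc : 0 ≤ c) {p q : ℕ} (hp : p ≠ 0) (hq : q ≠ 0)
    (hpq : p.Coprime q) (s : Set ℝ) :
    ∑ i : Fin p, ∑ j : Fin q, ∫ x in s, arc c p i x * arc c q j x
      ≤ 4 * c ^ 2 + 2 * c / p := by
  have hint : ∀ ij : Fin p × Fin q, Integrable fun t =>
      arc c p 0 t * arc c q ij.2 (t + ((ij.1 : ℕ) : ℝ) / p) := fun ij => by
    have := (integrable_arc_mul_arc c p ij.1 q ij.2).comp_add_right (((ij.1 : ℕ) : ℝ) / p)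
    simpa only [arc_translate] using this
  rw [← Fintype.sum_prod_type' (f := fun (i : Fin p) (j : Fin q) =>
    ∫ x in s, arc c p i x * arc c q j x)]
  calc ∑ ij : Fin p × Fin q, ∫ x in s, arc c p ij.1 x * arc c q ij.2 x
      ≤ ∑ ij : Fin p × Fin q, ∫ t, arc c p 0 t * arc c q ij.2 (t + ((ij.1 : ℕ) : ℝ) / p) := by
        refine Finset.sum_le_sum fun ij _ => ?_
        refine (setIntegral_le_integral (integrable_arc_mul_arc c p ij.1 q ij.2)
          (ae_of_all _ fun x => mul_nonneg (arc_nonneg ..) (arc_nonneg ..))).trans_eq ?_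
        rw [← integral_add_right_eq_self _ (((ij.1 : ℕ) : ℝ) / p)]
        simp only [arc_translate]
    _ = ∫ t, arc c p 0 t * ∑ ij : Fin p × Fin q, arc c q ij.2 (t + ((ij.1 : ℕ) : ℝ) / p) := by
        simp only [Finset.mul_sum]
        rw [integral_finsetSum _ fun ij _ => hint ij]
    _ ≤ ∫ t, arc c p 0 t * (2 * (c * p) + 1) := by
        refine integral_mono ?_ ((integrable_arc c p 0).mul_const _) fun t =>
          mul_le_mul_of_nonneg_left (sum_arc_translate_le hc hp hq hpq t) (arc_nonneg ..)
        simp only [Finset.mul_sum]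
        exact integrable_finsetSum _ fun ij _ => hint ij
    _ = 4 * c ^ 2 + 2 * c / p := by
        rw [integral_mul_const, integral_arc hc]
        field_simp
        ring

/-- The covariance on `[0,1]` of two indicator functions around their ideal mean values. -/
noncomputable def arcCov (c : ℝ) (p q i j : ℕ) : ℝ :=
  ∫ x in Set.Icc (0 : ℝ) 1, (arc c p i x - 2 * c / p) * (arc c q j x - 2 * c / q)

lemma integrableOn_arc_sub_mul_arc_sub (c : ℝ) (p q i j : ℕ) :
    IntegrableOn (fun x => (arc c p i x - 2 * c / p) * (arc c q j x - 2 * c / q))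
      (Set.Icc (0 : ℝ) 1) := by
  have h : (fun x => (arc c p i x - 2 * c / p) * (arc c q j x - 2 * c / q)) = fun x =>
      arc c p i x * arc c q j x - 2 * c / p * arc c q j x - 2 * c / q * arc c p i x
        + 2 * c / p * (2 * c / q) := by
    ext x; ring
  rw [h]
  exact (((integrable_arc_mul_arc c p i q j).integrableOn.sub
    ((integrable_arc c q j).integrableOn.const_mul _)).sub
    ((integrable_arc c p i).integrableOn.const_mul _)).add (integrableOn_const (by simp))

lemma arcCov_eq (c : ℝ) (p q i j : ℕ) :
    arcCov c p q i j = (∫ x in Set.Icc (0 : ℝ) 1, arc c p i x * arc c q j x)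
      - 2 * c / p * (∫ x in Set.Icc (0 : ℝ) 1, arc c q j x)
      - 2 * c / q * (∫ x in Set.Icc (0 : ℝ) 1, arc c p i x) + 2 * c / p * (2 * c / q) := by
  have h : ∀ x, (arc c p i x - 2 * c / p) * (arc c q j x - 2 * c / q) =
      arc c p i x * arc c q j x - 2 * c / p * arc c q j x - 2 * c / q * arc c p i x
        + 2 * c / p * (2 * c / q) := fun x => by ring
  have h1 := (integrable_arc_mul_arc c p i q j).integrableOn (s := Set.Icc (0 : ℝ) 1)
  have h2 := ((integrable_arc c q j).integrableOn (s := Set.Icc (0 : ℝ) 1)).const_mul (2 * c / p)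
  have h3 := ((integrable_arc c p i).integrableOn (s := Set.Icc (0 : ℝ) 1)).const_mul (2 * c / q)
  unfold arcCov
  simp only [h]
  rw [integral_add (by exact (h1.sub h2).sub h3) (integrable_const _),
    integral_sub (by exact h1.sub h2) h3, integral_sub h1 h2, integral_const_mul, integral_const_mul]
  simp

lemma sum_arcCov_le {c : ℝ} (hc0 : 0 < c) (hc : c ≤ 1 / 2) {p q : ℕ} (hp : p ≠ 0) (hq : q ≠ 0)
    (hpq : p.Coprime q) :
    ∑ i : Fin p, ∑ j : Fin q, arcCov c p q i j ≤ 2 / p + 1 / q := by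
  have hp' : (0 : ℝ) < p := by positivity
  have hq' : (0 : ℝ) < q := by positivity
  simp only [arcCov_eq, Finset.sum_add_distrib, Finset.sum_sub_distrib, Finset.sum_const,
    Finset.card_univ, Fintype.card_fin, nsmul_eq_mul, ← Finset.mul_sum]
  have h1 := sum_setIntegral_arc_mul_arc_le hc0.le hp hq hpq (Set.Icc 0 1)
  have h2 := le_sum_setIntegral_arc hc0 hc hp
  have h3 := le_sum_setIntegral_arc hc0 hc hq
  set S := ∑ i : Fin p, ∫ x in Set.Icc (0 : ℝ) 1, arc c p i x
  set T := ∑ j : Fin q, ∫ x in Set.Icc (0 : ℝ) 1, arc c q j x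
  have e1 : (p : ℝ) * (2 * c / p * T) = 2 * c * T := by field_simp
  have e2 : (q : ℝ) * (2 * c / q * S) = 2 * c * S := by field_simp
  have e3 : (p : ℝ) * (q * (2 * c / p * (2 * c / q))) = 4 * c ^ 2 := by field_simp; ring
  have hcc : 4 * c ^ 2 ≤ 1 := by nlinarith
  have h4 : (2 * c + 4 * c ^ 2) / p ≤ 2 / p := by gcongr; linarith
  have h5 : 4 * c ^ 2 / q ≤ 1 / q := by gcongr
  have h6 : 2 * c * (2 * c - 2 * c / p) ≤ 2 * c * S := by gcongr
  have h7 : 2 * c * (2 * c - 2 * c / q) ≤ 2 * c * T := by gcongr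
  have e4 : 2 * c * (2 * c - 2 * c / p) = 4 * c ^ 2 - 4 * c ^ 2 / p := by ring
  have e5 : 2 * c * (2 * c - 2 * c / q) = 4 * c ^ 2 - 4 * c ^ 2 / q := by ring
  rw [add_div] at h4
  linarith

lemma arcCov_self_le {c : ℝ} (hc0 : 0 < c) (hc : c ≤ 1 / 2) {p : ℕ} (hp : p ≠ 0) (i : ℕ) :
    arcCov c p p i i ≤ 2 / p := by
  have hp' : (1 : ℝ) ≤ p := by exact_mod_cast Nat.one_le_iff_ne_zero.2 hp
  have h1 := setIntegral_arc_le hc0.le p i (Set.Icc 0 1)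
  have h0 : 0 ≤ ∫ x in Set.Icc (0 : ℝ) 1, arc c p i x := integral_nonneg (arc_nonneg _ _ _)
  have hsq : ∀ x, arc c p i x * arc c p i x = arc c p i x := fun x => by
    rw [arc_eq_ite]; split_ifs <;> norm_num
  rw [arcCov_eq]
  simp only [hsq]
  have h2 : 0 ≤ 2 * c / p * ∫ x in Set.Icc (0 : ℝ) 1, arc c p i x := by positivity
  have h3 : 2 * c / p ≤ 1 / p := by gcongr; linarith
  have h4 : 2 * c / p ≤ 1 := by rw [div_le_one (by positivity)]; linarith
  have h5 : 2 * c / p * (2 * c / p) ≤ 2 * c / p := mul_le_of_le_one_right (by positivity) h4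
  have h6 : (2 : ℝ) / p = 1 / p + 1 / p := by ring
  linarith

lemma measurableSet_coord_eq (p : Nat.Primes) (i : Fin (p : ℕ)) :
    MeasurableSet {a : PrimeSeq | a p = i} :=
  (measurable_pi_apply (X := fun r : Nat.Primes => Fin (r : ℕ)) p) (measurableSet_singleton i)

lemma IsUniformProductMeasure.measureReal_pair {μ : Measure PrimeSeq}
    (hμ : IsUniformProductMeasure μ) {p q : Nat.Primes} (hpq : p ≠ q) (i : Fin (p : ℕ))
    (j : Fin (q : ℕ)) :
    μ.real ({a | a p = i} ∩ {a | a q = j}) = ((p : ℕ) : ℝ)⁻¹ * ((q : ℕ) : ℝ)⁻¹ := by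
  classical
  let v : PrimeSeq := Function.update (Function.update (fun r => ⟨0, r.2.pos⟩) p i) q j
  have hvp : v p = i := by simp [v, Function.update_of_ne hpq]
  have hvq : v q = j := by simp [v]
  have h := hμ.2 {p, q} v
  rw [Finset.prod_pair hpq] at h
  have hset : {a : PrimeSeq | a p = i} ∩ {a | a q = j}
      = {a : PrimeSeq | ∀ r ∈ ({p, q} : Finset Nat.Primes), a r = v r} := by
    ext a; simp [hvp, hvq]
  rw [hset, measureReal_def, h]
  simp

lemma integrable_comp_coord_pair (μ : Measure PrimeSeq) [IsFiniteMeasure μ] (p q : Nat.Primes)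
    (F : Fin (p : ℕ) → Fin (q : ℕ) → ℝ) : Integrable (fun a : PrimeSeq => F (a p) (a q)) μ := by
  have hm : Measurable fun a : PrimeSeq => F (a p) (a q) :=
    (measurable_of_countable fun z : Fin (p : ℕ) × Fin (q : ℕ) => F z.1 z.2).comp
      ((measurable_pi_apply (X := fun r : Nat.Primes => Fin (r : ℕ)) p).prodMk
        (measurable_pi_apply (X := fun r : Nat.Primes => Fin (r : ℕ)) q))
  refine Integrable.of_bound hm.aestronglyMeasurable (∑ i, ∑ j, ‖F i j‖) (ae_of_all _ fun a => ?_)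
  exact (Finset.single_le_sum (f := fun j => ‖F (a p) j‖) (fun _ _ => norm_nonneg _)
    (Finset.mem_univ (a q))).trans (Finset.single_le_sum (f := fun i => ∑ j, ‖F i j‖)
    (fun _ _ => Finset.sum_nonneg fun _ _ => norm_nonneg _) (Finset.mem_univ (a p)))

lemma IsUniformProductMeasure.integral_comp_coord_pair {μ : Measure PrimeSeq}
    (hμ : IsUniformProductMeasure μ) {p q : Nat.Primes} (hpq : p ≠ q)
    (F : Fin (p : ℕ) → Fin (q : ℕ) → ℝ) :
    ∫ a, F (a p) (a q) ∂μ
      = ((p : ℕ) : ℝ)⁻¹ * ((q : ℕ) : ℝ)⁻¹ * ∑ i, ∑ j, F i j := by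
  have := hμ.1
  have hms : ∀ i j, MeasurableSet ({a : PrimeSeq | a p = i} ∩ {a | a q = j}) := fun i j =>
    (measurableSet_coord_eq p i).inter (measurableSet_coord_eq q j)
  have hF : ∀ a : PrimeSeq, F (a p) (a q) = ∑ i, ∑ j,
      ({a : PrimeSeq | a p = i} ∩ {a | a q = j}).indicator (fun _ => F i j) a := fun a => by
    classical
    rw [Finset.sum_eq_single (a p), Finset.sum_eq_single (a q)]
    · simp
    · intro j _ hj; simp [hj.symm]
    · simp
    · intro i _ hi; simp [hi.symm]
    · simp
  have hint : ∀ i j, Integrable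
      (({a : PrimeSeq | a p = i} ∩ {a | a q = j}).indicator fun _ => F i j) μ := fun i j =>
    (integrable_const _).indicator (hms i j)
  simp only [hF]
  rw [integral_finsetSum _ fun i _ => integrable_finsetSum _ fun j _ => hint i j]
  simp only [Finset.mul_sum]
  refine Finset.sum_congr rfl fun i _ => ?_
  rw [integral_finsetSum _ fun j _ => hint i j]
  refine Finset.sum_congr rfl fun j _ => ?_
  rw [integral_indicator_const _ (hms i j), hμ.measureReal_pair hpq, smul_eq_mul]

lemma finite_primes_Ioc (X Y : ℝ) :
    {p : Nat.Primes | X < ((p : ℕ) : ℝ) ∧ ((p : ℕ) : ℝ) ≤ Y}.Finite := by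
  refine Set.Finite.subset (Set.Finite.preimage (f := fun p : Nat.Primes => (p : ℕ))
    Subtype.val_injective.injOn (Set.finite_Iic ⌊Y⌋₊)) fun p hp => ?_
  exact Nat.le_floor hp.2

/-- The finite set of primes `X < p ≤ Y`. -/
noncomputable def primesIoc (X Y : ℝ) : Finset Nat.Primes := (finite_primes_Ioc X Y).toFinset

lemma mem_primesIoc {X Y : ℝ} {p : Nat.Primes} :
    p ∈ primesIoc X Y ↔ X < ((p : ℕ) : ℝ) ∧ ((p : ℕ) : ℝ) ≤ Y := by
  simp [primesIoc]

lemma Hsum_eq_sum (X Y : ℝ) : Hsum X Y = ∑ p ∈ primesIoc X Y, 1 / ((p : ℕ) : ℝ) := by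
  rw [← Finset.tsum_subtype (primesIoc X Y) fun p : Nat.Primes => 1 / ((p : ℕ) : ℝ)]
  let e : {p : Nat.Primes // p ∈ primesIoc X Y} ≃
      {p : ℕ // p.Prime ∧ X < (p : ℝ) ∧ (p : ℝ) ≤ Y} :=
    { toFun := fun p => ⟨p.1, p.1.2, mem_primesIoc.1 p.2⟩
      invFun := fun p => ⟨⟨p.1, p.2.1⟩, mem_primesIoc.2 p.2.2⟩
      left_inv := fun _ => rfl
      right_inv := fun _ => rfl }
  exact (e.tsum_eq fun p => (1 : ℝ) / ((p : ℕ) : ℝ)).symm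

lemma Ncount_eq_sum (c X Y : ℝ) (a : PrimeSeq) (x : ℝ) :
    Ncount c X Y a x = ∑ p ∈ primesIoc X Y, arc c p (a p) x := by
  classical
  simp only [arc_eq_ite]
  rw [Finset.sum_boole, Ncount, Nat.subtype_card]
  intro p
  rw [Finset.mem_filter, mem_primesIoc, and_assoc]

lemma setIntegral_sq_Ncount_sub (c X Y : ℝ) (a : PrimeSeq) :
    ∫ x in Set.Icc (0 : ℝ) 1, (Ncount c X Y a x - 2 * c * Hsum X Y) ^ 2
      = ∑ p ∈ primesIoc X Y, ∑ q ∈ primesIoc X Y, arcCov c p q (a p) (a q) := by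
  have h : ∀ x, (Ncount c X Y a x - 2 * c * Hsum X Y) ^ 2 =
      ∑ p ∈ primesIoc X Y, ∑ q ∈ primesIoc X Y,
        (arc c p (a p) x - 2 * c / (p : ℕ)) * (arc c q (a q) x - 2 * c / (q : ℕ)) := fun x => by
    rw [Ncount_eq_sum, Hsum_eq_sum, Finset.mul_sum, ← Finset.sum_sub_distrib, sq,
      Finset.sum_mul_sum]
    simp only [mul_one_div]
  simp only [h]
  rw [integral_finsetSum _ fun p _ => integrable_finsetSum _ fun q _ =>
    integrableOn_arc_sub_mul_arc_sub ..]
  refine Finset.sum_congr rfl fun p _ => ?_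
  rw [integral_finsetSum _ fun q _ => integrableOn_arc_sub_mul_arc_sub ..]
  rfl

lemma IsUniformProductMeasure.integral_arcCov_le {μ : Measure PrimeSeq}
    (hμ : IsUniformProductMeasure μ) {c : ℝ} (hc0 : 0 < c) (hc : c ≤ 1 / 2) (p q : Nat.Primes) :
    ∫ a, arcCov c p q (a p) (a q) ∂μ ≤ (if p = q then 2 * (1 / ((p : ℕ) : ℝ)) else 0)
      + (2 * (1 / ((p : ℕ) : ℝ) ^ 2 * (1 / ((q : ℕ) : ℝ)))
        + 1 / ((p : ℕ) : ℝ) * (1 / ((q : ℕ) : ℝ) ^ 2)) := by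
  have := hμ.1
  split_ifs with hpq
  · subst hpq
    have h : ∫ a, arcCov c p p (a p) (a p) ∂μ ≤ ∫ _, (2 / ((p : ℕ) : ℝ)) ∂μ :=
      integral_mono (integrable_comp_coord_pair μ p p fun i j => arcCov c p p i j)
        (integrable_const _) fun a => arcCov_self_le hc0 hc p.2.ne_zero _
    rw [integral_const, probReal_univ, one_smul] at h
    have h' : 0 ≤ 2 * (1 / ((p : ℕ) : ℝ) ^ 2 * (1 / ((p : ℕ) : ℝ)))
        + 1 / ((p : ℕ) : ℝ) * (1 / ((p : ℕ) : ℝ) ^ 2) := by positivity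
    rw [mul_one_div]
    linarith
  · rw [hμ.integral_comp_coord_pair hpq fun i j => arcCov c p q i j, zero_add]
    have hcop : (p : ℕ).Coprime q :=
      (Nat.coprime_primes p.2 q.2).2 fun h => hpq (Subtype.ext h)
    refine (mul_le_mul_of_nonneg_left (sum_arcCov_le hc0 hc p.2.ne_zero q.2.ne_zero hcop)
      (by positivity)).trans_eq ?_
    have := p.2.pos
    have := q.2.pos
    field_simp

lemma sum_primes_one_div_sq_le (s : Finset Nat.Primes) :
    ∑ p ∈ s, 1 / ((p : ℕ) : ℝ) ^ 2 ≤ ∑' n : ℕ, 1 / (n : ℝ) ^ 2 := by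
  refine (Finset.sum_map s ⟨fun p : Nat.Primes => (p : ℕ), Subtype.val_injective⟩
    fun n : ℕ => 1 / (n : ℝ) ^ 2).symm.trans_le ?_
  exact (Real.summable_one_div_nat_pow.2 one_lt_two).sum_le_tsum _ fun _ _ => by positivity

/-- For `0 < c ≤ 1/2` there is a constant `C ≥ 0` (depending only on `c`) such that for
all reals `1 ≤ X < Y`, the expectation over `a ∈ 𝒜` of
`α_{X,Y} = ∫₀¹ (N_{X,Y}(x) - ν_{X,Y})² dx`, with `ν_{X,Y} = 2c H_{X,Y}`, is at most
`C · H_{X,Y}`. -/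
theorem expected_variance_le (c : ℝ) (hc0 : 0 < c) (hc : c ≤ 1 / 2) :
    ∃ C : ℝ, 0 ≤ C ∧
      ∀ (μ : Measure PrimeSeq), IsUniformProductMeasure μ →
        ∀ X Y : ℝ, 1 ≤ X → X < Y →
          (∫ a : PrimeSeq,
              (∫ x in Set.Icc (0 : ℝ) 1, (Ncount c X Y a x - 2 * c * Hsum X Y) ^ 2) ∂μ)
            ≤ C * Hsum X Y := by
  set K : ℝ := ∑' n : ℕ, 1 / (n : ℝ) ^ 2
  have hK : 0 ≤ K := tsum_nonneg fun _ => by positivity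
  refine ⟨2 + 3 * K, by positivity, fun μ hμ X Y _ _ => ?_⟩
  have := hμ.1
  have hint : ∀ p q : Nat.Primes, Integrable (fun a : PrimeSeq => arcCov c p q (a p) (a q)) μ :=
    fun p q => integrable_comp_coord_pair μ p q fun i j => arcCov c p q i j
  simp only [setIntegral_sq_Ncount_sub]
  rw [integral_finsetSum _ fun p _ => integrable_finsetSum _ fun q _ => hint p q]
  simp only [integral_finsetSum _ fun q _ => hint _ q]
  refine (Finset.sum_le_sum fun p _ => Finset.sum_le_sum fun q _ =>
    hμ.integral_arcCov_le hc0 hc p q).trans ?_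
  set P := primesIoc X Y
  have hH : Hsum X Y = ∑ p ∈ P, 1 / ((p : ℕ) : ℝ) := Hsum_eq_sum X Y
  have hH0 : 0 ≤ Hsum X Y := by rw [hH]; positivity
  have hdiag : ∑ p ∈ P, ∑ q ∈ P, (if p = q then 2 * (1 / ((p : ℕ) : ℝ)) else 0)
      = 2 * Hsum X Y := by
    rw [hH, Finset.mul_sum]
    refine Finset.sum_congr rfl fun p hp => ?_
    rw [Finset.sum_ite_eq, if_pos hp]
  simp only [Finset.sum_add_distrib, ← Finset.mul_sum]
  rw [hdiag, ← Finset.sum_mul, ← Finset.sum_mul, ← hH]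
  have hS : ∑ p ∈ P, 1 / ((p : ℕ) : ℝ) ^ 2 ≤ K := sum_primes_one_div_sq_le P
  nlinarith [mul_le_mul_of_nonneg_left hS hH0]
end
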